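/- arXiv:0912.4977 — 2 statements merged into one kernel-verified Lean document; each statement's English description precedes it below -/
import Mathlib

section
/- Let Σ be the σ-algebra on 𝔾 generated by the sets O(S) for all S ⊆ 𝒫. Then there exists a countably additive probability measure μ on (𝔾, Σ) such that μ(O(S)) = lim_{x→∞} ∏_{p prime, p ≤ x} P_p(S) for every S ⊆ 𝒫. (The global Cohen–Lenstra probability measure exists and makes all uniform properties measurable.) -/
open Filter Topology

/-- The type of all integer partitions (of all natural numbers `n`). -/
def PartitionsAll : Type := Σ n : ℕ, Nat.Partition n

/-- The empty partition of `0`. -/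
def partZero : PartitionsAll := ⟨0, ⟨0, by simp, rfl⟩⟩

/-- The unique partition of `1`. -/
def partOne : PartitionsAll :=
  ⟨1, ⟨{1}, by intro i hi; rw [Multiset.mem_singleton] at hi; omega, rfl⟩⟩

instance : Zero PartitionsAll := ⟨partZero⟩

/-- The set of isomorphism classes of finite abelian groups, identified with the
finitely supported families of partitions indexed by the primes. -/
abbrev GG : Type := Nat.Primes →₀ PartitionsAll

/-- The finite abelian `p`-group `⊕ⱼ ℤ/p^{λ_j}ℤ` corresponding to a partition `λ`. -/
abbrev pGroup (p : ℕ) (lam : PartitionsAll) : Type :=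
  ∀ i : Fin lam.2.parts.toList.length, ZMod (p ^ lam.2.parts.toList.get i)

/-- The Cohen–Lenstra weight `w_p(λ) = 1/#Aut(G_{p,λ})`. -/
noncomputable def wCL (p : ℕ) (lam : PartitionsAll) : ℝ :=
  ((Nat.card (AddAut (pGroup p lam)) : ℝ))⁻¹

/-- `∏_{i=1}^∞ (1 - p^{-i})`. -/
noncomputable def clC (p : ℕ) : ℝ := ∏' i : ℕ, (1 - ((p : ℝ))⁻¹ ^ (i + 1))

/-- The local Cohen–Lenstra probability `P_p(S) = (∑_{λ∈S} w_p(λ)) ∏_{i≥1}(1-p^{-i})`. -/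
noncomputable def Pp (p : ℕ) (S : Set PartitionsAll) : ℝ :=
  (∑' lam : S, wCL p lam) * clC p

/-- The primes `≤ x`. -/
def primesUpTo (x : ℕ) : Finset ℕ := Nat.primesBelow (x + 1)

/-- The partial products `∏_{p ≤ x} P_p(S)`. -/
noncomputable def globPartial (S : Set PartitionsAll) (x : ℕ) : ℝ :=
  ∏ p ∈ primesUpTo x, Pp p S

/-- The global value `lim_{x→∞} ∏_{p ≤ x} P_p(S)` (the limit exists since all
factors lie in `[0,1]`). -/
noncomputable def glob (S : Set PartitionsAll) : ℝ :=
  limUnder atTop (globPartial S)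

/-- `O(S) = {G : G_p ∈ S for all primes p}`. -/
def Oset (S : Set PartitionsAll) : Set GG := {G : GG | ∀ p : Nat.Primes, G p ∈ S}

/-- `O(E₁, …, E_r) = O(E₁) ∪ … ∪ O(E_r)`. -/
def OOset {r : ℕ} (E : Fin r → Set PartitionsAll) : Set GG := ⋃ i, Oset (E i)

/-- Inclusion–exclusion value of `O(E₁, …, E_r)`. -/
noncomputable def PO {r : ℕ} (E : Fin r → Set PartitionsAll) : ℝ :=
  ∑ T ∈ Finset.univ.filter (fun T : Finset (Fin r) => T.Nonempty),
    (-1 : ℝ) ^ (T.card + 1) * glob (⋂ i ∈ T, E i)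

/-- The collection `𝔇` of sets `D(E₁,…,E_r;F₁,…,F_s)`. -/
def DD : Set (Set GG) :=
  {A | ∃ (r s : ℕ) (E : Fin r → Set PartitionsAll) (F : Fin s → Set PartitionsAll),
      OOset F ⊆ OOset E ∧ A = OOset E \ OOset F}

/-- The value `P(D)` of a set `D ∈ 𝔇` (well-defined: it depends only on the set `D`). -/
noncomputable def PDval (A : Set GG) : ℝ :=
  sSup {x : ℝ | ∃ (r s : ℕ) (E : Fin r → Set PartitionsAll) (F : Fin s → Set PartitionsAll),
      OOset F ⊆ OOset E ∧ A = OOset E \ OOset F ∧ x = PO E - PO F}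

/-- The outer measure `ν`. -/
noncomputable def nuCL (A : Set GG) : ℝ :=
  sInf {x : ℝ | ∃ C : ℕ → Set GG, (∀ i, C i ∈ DD) ∧ A ⊆ ⋃ i, C i ∧ x = ∑' i, PDval (C i)}

/-- The order of a finite abelian group. -/
def ordG (G : GG) : ℕ := G.prod fun p lam => (p : ℕ) ^ lam.1

/-- The exponent of a finite abelian group. -/
def expG (G : GG) : ℕ := G.prod fun p lam => (p : ℕ) ^ lam.2.parts.sup

/-- The σ-algebra on `𝔾` generated by the sets `O(S)` for all uniform properties `S ⊆ 𝒫`. -/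
def glSigma : MeasurableSpace GG :=
  MeasurableSpace.generateFrom {A : Set GG | ∃ S : Set PartitionsAll, A = Oset S}

open scoped ENNReal DirectSum

/-- The subgroup of `A × ℤ` with kernel part `H`, projection `dℤ` and gluing class `c`. -/
def extensionSubgroup {A : Type*} [AddCommGroup A] (H : AddSubgroup A) (d : ℤ) (c : A ⧸ H) :
    AddSubgroup (A × ℤ) :=
  ((QuotientAddGroup.mk' H).coprod (-(zmultiplesHom _ c))).ker.map
    ((AddMonoidHom.id A).prodMap (AddMonoidHom.mulRight d))

theorem mem_extensionSubgroup {A : Type*} [AddCommGroup A] {H : AddSubgroup A} {d : ℤ}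
    {c : A ⧸ H} {x : A} {y : ℤ} :
    (x, y) ∈ extensionSubgroup H d c ↔ ∃ m : ℤ, y = m * d ∧ (x : A ⧸ H) = m • c := by
  simp only [extensionSubgroup, AddSubgroup.mem_map, AddMonoidHom.mem_ker, Prod.exists,
    AddMonoidHom.coprod_apply, QuotientAddGroup.mk'_apply, AddMonoidHom.neg_apply,
    zmultiplesHom_apply, AddMonoidHom.prodMap_def, AddMonoidHom.prod_apply, Prod.mk.injEq,
    AddMonoidHom.coe_comp, Function.comp_apply, AddMonoidHom.coe_fst, AddMonoidHom.coe_snd,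
    AddMonoidHom.id_apply, AddMonoidHom.coe_mulRight, ← sub_eq_add_neg, sub_eq_zero]
  constructor
  · rintro ⟨a, m, h, rfl, rfl⟩
    exact ⟨m, rfl, h⟩
  · rintro ⟨m, rfl, h⟩
    exact ⟨x, m, h, rfl, rfl⟩

theorem index_extensionSubgroup {A : Type*} [AddCommGroup A] (H : AddSubgroup A) {d : ℤ}
    (hd : d ≠ 0) (c : A ⧸ H) : (extensionSubgroup H d c).index = H.index * d.natAbs := by
  have hinj : Function.Injective
      ((AddMonoidHom.id A).prodMap (AddMonoidHom.mulRight d)) := by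
    rintro ⟨a, m⟩ ⟨b, n⟩ h
    simp_all [AddMonoidHom.prodMap_def]
  rw [extensionSubgroup, AddSubgroup.index_map_of_injective _ hinj, AddSubgroup.index_ker]
  congr 1
  · rw [AddMonoidHom.range_eq_top.2, AddSubgroup.index]
    · exact Nat.card_congr AddSubgroup.topEquiv.toEquiv
    · intro q
      obtain ⟨a, rfl⟩ := QuotientAddGroup.mk_surjective q
      exact ⟨(a, 0), by simp⟩
  · have : ((AddMonoidHom.id A).prodMap (AddMonoidHom.mulRight d)).range =
        (⊤ : AddSubgroup A).prod (AddSubgroup.zmultiples d) := by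
      ext ⟨a, m⟩
      simp [AddMonoidHom.prodMap_def, AddSubgroup.mem_prod, AddSubgroup.mem_zmultiples_iff]
    rw [this, AddSubgroup.index_prod, AddSubgroup.index_top, one_mul, Int.index_zmultiples]

/-- The subgroups whose index is a power of `p`. -/
abbrev PPowSubgroup (A : Type*) [AddCommGroup A] (p : ℕ) : Type _ :=
  {H : AddSubgroup A // ∃ n, H.index = p ^ n}

/-- Value at `s` of the subgroup zeta function of `A` at `p`. -/
noncomputable def subgroupZeta (A : Type*) [AddCommGroup A] (p s : ℕ) : ℝ≥0∞ :=
  ∑' H : PPowSubgroup A p, ((H.1.index : ℝ≥0∞) ^ s)⁻¹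

theorem extensionSubgroup_bijective (A : Type*) [AddCommGroup A] {p : ℕ} (hp : p.Prime) :
    Function.Bijective (fun t : (H : PPowSubgroup A p) × ℕ × (A ⧸ H.1) ↦
      (⟨extensionSubgroup t.1.1 ((p : ℤ) ^ t.2.1) t.2.2, by
        obtain ⟨⟨H, n, hn⟩, b, c⟩ := t
        refine ⟨n + b, ?_⟩
        rw [index_extensionSubgroup _ (pow_ne_zero _ (by exact_mod_cast hp.ne_zero)), pow_add]
        simp [Int.natAbs_pow, hn]⟩ : PPowSubgroup (A × ℤ) p)) := by
  have hp0 : (p : ℤ) ≠ 0 := by exact_mod_cast hp.ne_zero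
  constructor
  · rintro ⟨⟨H, hH⟩, b, c⟩ ⟨⟨H', hH'⟩, b', c'⟩ h
    have h : ∀ x y, (x, y) ∈ extensionSubgroup H ((p : ℤ) ^ b) c ↔
        (x, y) ∈ extensionSubgroup H' ((p : ℤ) ^ b') c' := by
      intro x y
      rw [Subtype.mk.injEq] at h
      rw [h]
    simp only [mem_extensionSubgroup] at h
    have hHH : H = H' := by
      ext x
      simpa [hp.ne_zero] using h x 0
    subst hHH
    have hdvd : ∀ {b b' : ℕ} {c c' : A ⧸ H}, (∀ (x : A) (y : ℤ), (∃ m : ℤ, y = m * (p : ℤ) ^ b ∧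
        (x : A ⧸ H) = m • c) ↔ (∃ m : ℤ, y = m * (p : ℤ) ^ b' ∧ (x : A ⧸ H) = m • c')) →
        b' ≤ b := by
      intro b b' c c' h
      obtain ⟨x, rfl⟩ := QuotientAddGroup.mk_surjective c
      obtain ⟨m, hm, -⟩ := (h x ((p : ℤ) ^ b)).1 ⟨1, by simp⟩
      have : p ^ b' ∣ p ^ b := by
        have hdvd : (p : ℤ) ^ b' ∣ (p : ℤ) ^ b := Dvd.intro_left m hm.symm
        exact_mod_cast hdvd
      exact (Nat.pow_dvd_pow_iff_le_right hp.one_lt).1 this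
    obtain rfl : b = b' := le_antisymm (hdvd fun x y ↦ (h x y).symm) (hdvd h)
    obtain ⟨x, rfl⟩ := QuotientAddGroup.mk_surjective c
    obtain ⟨m, hm, hx⟩ := (h x ((p : ℤ) ^ b)).1 ⟨1, by simp⟩
    obtain rfl : m = 1 := by
      have : (m - 1) * (p : ℤ) ^ b = 0 := by linarith
      rcases mul_eq_zero.1 this with h | h
      · linarith
      · exact absurd h (pow_ne_zero _ hp0)
    simp [hx]
  · rintro ⟨L, n, hL⟩
    have h1 : ∃ k, (L.comap (AddMonoidHom.inl A ℤ)).index = p ^ k := by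
      rw [AddSubgroup.index_comap]
      obtain ⟨k, -, hk⟩ := (Nat.dvd_prime_pow hp).1
        (hL ▸ AddSubgroup.relIndex_dvd_index_of_normal L (AddMonoidHom.inl A ℤ).range)
      exact ⟨k, hk⟩
    obtain ⟨b, -, hb⟩ := (Nat.dvd_prime_pow hp).1
      (hL ▸ L.index_map_dvd (f := AddMonoidHom.snd A ℤ) (fun y ↦ ⟨(0, y), rfl⟩))
    have hz : L.map (AddMonoidHom.snd A ℤ) = AddSubgroup.zmultiples ((p : ℤ) ^ b) := by
      obtain ⟨a, ha⟩ := Int.subgroup_cyclic (L.map (AddMonoidHom.snd A ℤ))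
      rw [← AddSubgroup.zmultiples_eq_closure] at ha
      rw [ha, Int.index_zmultiples] at hb
      rcases Int.natAbs_eq a with h | h <;> rw [ha, h, hb] <;> simp
    obtain ⟨⟨x₀, y₀⟩, hx₀, hy₀⟩ : (p : ℤ) ^ b ∈ L.map (AddMonoidHom.snd A ℤ) := by
      rw [hz]; exact AddSubgroup.mem_zmultiples _
    obtain rfl : y₀ = (p : ℤ) ^ b := hy₀
    refine ⟨⟨⟨_, h1⟩, b, (x₀ : A ⧸ _)⟩, Subtype.ext ?_⟩
    ext ⟨x, y⟩
    have key : ∀ m : ℤ, (x : A ⧸ L.comap (AddMonoidHom.inl A ℤ)) = m • (x₀ : A ⧸ _) ↔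
        (x, m * (p : ℤ) ^ b) ∈ L := by
      intro m
      rw [← QuotientAddGroup.mk_zsmul, eq_comm, QuotientAddGroup.eq, AddSubgroup.mem_comap,
        ← AddSubgroup.add_mem_cancel_left (x := m • (x₀, (p : ℤ) ^ b)) L
          (AddSubgroup.zsmul_mem _ hx₀ m)]
      simp
    simp only [mem_extensionSubgroup, key]
    constructor
    · rintro ⟨m, rfl, h⟩
      exact h
    · intro h
      have : y ∈ L.map (AddMonoidHom.snd A ℤ) := ⟨_, h, rfl⟩
      rw [hz, AddSubgroup.mem_zmultiples_iff] at this
      obtain ⟨m, rfl⟩ := this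
      exact ⟨m, by simp, by simpa using h⟩

theorem subgroupZeta_prod_int (A : Type*) [AddCommGroup A] {p : ℕ} (hp : p.Prime) (s : ℕ) :
    subgroupZeta (A × ℤ) p (s + 1) =
      subgroupZeta A p s * ∑' b : ℕ, (((p : ℝ≥0∞) ^ (s + 1))⁻¹) ^ b := by
  have hp0 : (p : ℤ) ≠ 0 := by exact_mod_cast hp.ne_zero
  have he := (Equiv.ofBijective _ (extensionSubgroup_bijective A hp)).tsum_eq
    (fun H : PPowSubgroup (A × ℤ) p ↦ ((H.1.index : ℝ≥0∞) ^ (s + 1))⁻¹)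
  simp only [Equiv.ofBijective_apply, index_extensionSubgroup _ (pow_ne_zero _ hp0)] at he
  rw [subgroupZeta, ← he, ENNReal.tsum_sigma', subgroupZeta, ← ENNReal.tsum_mul_right]
  refine tsum_congr fun H ↦ ?_
  rw [ENNReal.tsum_prod', ← ENNReal.tsum_mul_left]
  refine tsum_congr fun b ↦ ?_
  obtain ⟨n, hn⟩ := H.2
  have hi : H.1.index ≠ 0 := hn ▸ pow_ne_zero _ hp.ne_zero
  have : Finite (A ⧸ H.1) := Nat.finite_of_card_ne_zero hi
  dsimp only
  rw [ENNReal.tsum_const, ENat.card_eq_coe_natCard]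
  change ((H.1.index : ℕ∞) : ℝ≥0∞) * _ = _
  have hi' : (H.1.index : ℝ≥0∞) ≠ 0 := by exact_mod_cast hi
  simp only [Int.natAbs_pow, Int.natAbs_natCast, ENat.toENNReal_coe, Nat.cast_mul, Nat.cast_pow]
  rw [mul_pow, ENNReal.mul_inv (by simp [hi']) (by simp), ← mul_assoc, pow_succ,
    ENNReal.mul_inv (by simp) (by simp), mul_comm (_)⁻¹ (_)⁻¹, ← mul_assoc,
    ENNReal.mul_inv_cancel hi' (by simp), one_mul, ← ENNReal.inv_pow, ← pow_mul, ← pow_mul,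
    mul_comm b]

theorem subgroupZeta_congr {A B : Type*} [AddCommGroup A] [AddCommGroup B] (e : A ≃+ B)
    (p s : ℕ) : subgroupZeta A p s = subgroupZeta B p s := by
  rw [subgroupZeta, subgroupZeta,
    ← (e.mapAddSubgroup.toEquiv.subtypeEquiv (p := fun H ↦ ∃ n, H.index = p ^ n)
      (q := fun H ↦ ∃ n, H.index = p ^ n) fun H ↦ by
        simp).tsum_eq]
  simp

theorem subgroupZeta_fin {p : ℕ} (hp : p.Prime) (k : ℕ) :
    subgroupZeta (Fin k → ℤ) p k = ∏ i ∈ Finset.range k, (1 - ((p : ℝ≥0∞)⁻¹) ^ (i + 1))⁻¹ := by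
  induction k with
  | zero =>
    have : ∃ n, (⊤ : AddSubgroup (Fin 0 → ℤ)).index = p ^ n := ⟨0, by simp⟩
    rw [subgroupZeta, tsum_eq_single ⟨⊤, this⟩]
    · simp
    · intro H hH
      exact absurd (Subtype.ext (Subsingleton.elim _ _)) hH
  | succ k ih =>
    let e : (Fin (k + 1) → ℤ) ≃+ (Fin k → ℤ) × ℤ :=
      ((Fin.consLinearEquiv ℤ (fun _ : Fin (k + 1) ↦ ℤ)).symm.trans
        (LinearEquiv.prodComm ℤ ℤ (Fin k → ℤ))).toAddEquiv
    rw [subgroupZeta_congr e, subgroupZeta_prod_int _ hp, ih, Finset.prod_range_succ,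
      ENNReal.tsum_geometric, ENNReal.inv_pow]

theorem sum_map_min_injective {s t : Multiset ℕ} (hs : ∀ i ∈ s, 0 < i) (ht : ∀ i ∈ t, 0 < i)
    (h : ∀ j, (s.map (min · j)).sum = (t.map (min · j)).sum) : s = t := by
  have key : ∀ (u : Multiset ℕ) (j : ℕ), 2 * (u.map (min · (j + 1))).sum =
      (u.map (min · j)).sum + (u.map (min · (j + 2))).sum + u.count (j + 1) := by
    intro u j
    induction u using Multiset.induction with
    | empty => simp
    | cons a u ih =>
      simp only [Multiset.map_cons, Multiset.sum_cons, Multiset.count_cons]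
      split_ifs <;> omega
  ext j
  rcases j with _ | j
  · rw [Multiset.count_eq_zero_of_notMem fun h0 ↦ (hs 0 h0).false,
      Multiset.count_eq_zero_of_notMem fun h0 ↦ (ht 0 h0).false]
  · have h1 := key s j
    have h2 := key t j
    rw [h, h, h] at h1
    omega

theorem card_torsion_pGroup {p : ℕ} (hp : p.Prime) (lam : PartitionsAll) (j : ℕ) :
    Nat.card {x : pGroup p lam // p ^ j • x = 0} = p ^ (lam.2.parts.map (min · j)).sum := by
  have hcyc (a : ℕ) : Nat.card {x : ZMod (p ^ a) // p ^ j • x = 0} = p ^ min a j := by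
    have : NeZero (p ^ a) := ⟨pow_ne_zero _ hp.ne_zero⟩
    have h := IsAddCyclic.card_nsmulAddMonoidHom_ker (ZMod (p ^ a)) (p ^ j)
    rw [Nat.card_zmod] at h
    have hg : (p ^ a).gcd (p ^ j) = p ^ min a j := by
      rcases le_total a j with h | h
      · rw [min_eq_left h, Nat.gcd_eq_left (pow_dvd_pow p h)]
      · rw [min_eq_right h, Nat.gcd_eq_right (pow_dvd_pow p h)]
    rw [← hg, ← h]
    rfl
  let e : {x : pGroup p lam // p ^ j • x = 0} ≃
      ∀ i : Fin lam.2.parts.toList.length,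
        {x : ZMod (p ^ lam.2.parts.toList.get i) // p ^ j • x = 0} :=
    (Equiv.subtypeEquivRight fun x ↦ by simp [funext_iff]).trans Equiv.subtypePiEquivPi
  rw [Nat.card_congr e, Nat.card_pi, Finset.prod_congr rfl fun i _ ↦ hcyc _,
    Finset.prod_pow_eq_pow_sum]
  congr 1
  conv_rhs => rw [← Multiset.coe_toList lam.2.parts]
  rw [Multiset.map_coe, Multiset.sum_coe, ← Fin.sum_univ_fun_getElem]
  rfl

theorem card_torsion_congr {G H : Type*} [AddMonoid G] [AddMonoid H] (e : G ≃+ H) (m : ℕ) :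
    Nat.card {x : G // m • x = 0} = Nat.card {x : H // m • x = 0} :=
  Nat.card_congr (e.toEquiv.subtypeEquiv fun x ↦ by simp [← map_nsmul])

theorem eq_of_pGroup_addEquiv {p : ℕ} (hp : p.Prime) {lam mu : PartitionsAll}
    (e : pGroup p lam ≃+ pGroup p mu) : lam = mu := by
  have h : lam.2.parts = mu.2.parts := by
    refine sum_map_min_injective (fun _ h ↦ lam.2.parts_pos h) (fun _ h ↦ mu.2.parts_pos h)
      fun j ↦ Nat.pow_right_injective hp.two_le ?_
    simp only
    rw [← card_torsion_pGroup hp, ← card_torsion_pGroup hp]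
    exact card_torsion_congr e _
  obtain ⟨n, s, hs, rfl⟩ := lam
  obtain ⟨m, t, ht, rfl⟩ := mu
  obtain rfl : s = t := h
  rfl

theorem exists_equiv_of_map_univ_eq {α β γ : Type*} [Fintype α] [Fintype β] {f : α → γ}
    {g : β → γ} (h : Finset.univ.val.map f = Finset.univ.val.map g) :
    ∃ e : α ≃ β, ∀ a, g (e a) = f a := by
  classical
  have hcard (c : γ) : Fintype.card {a // f a = c} = Fintype.card {b // g b = c} := by
    have := congrArg (Multiset.count c) h
    simp only [Multiset.count_map, eq_comm (a := c)] at this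
    rw [Fintype.card_subtype, Fintype.card_subtype]
    exact this
  let e (c : γ) : {a // f a = c} ≃ {b // g b = c} := Fintype.equivOfCardEq (hcard c)
  exact ⟨Equiv.ofFiberEquiv e, Equiv.ofFiberEquiv_map e⟩

theorem exists_pGroup_addEquiv {p : ℕ} (hp : p.Prime) (G : Type*) [AddCommGroup G] {n : ℕ}
    (hG : Nat.card G = p ^ n) : ∃ lam : PartitionsAll, Nonempty (G ≃+ pGroup p lam) := by
  have : Finite G := Nat.finite_of_card_ne_zero (hG ▸ pow_ne_zero _ hp.ne_zero)
  obtain ⟨ι, _, a, ha, ⟨f⟩⟩ := AddCommGroup.equiv_directSum_zmod_of_finite' G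
  let f' : G ≃+ ∀ i, ZMod (a i) := f.trans (DirectSum.addEquivProd _)
  have hcard : ∏ i, a i = p ^ n := by
    rw [← hG, Nat.card_congr f'.toEquiv, Nat.card_pi]
    simp
  have hpow (i : ι) : ∃ b, a i = p ^ b := by
    obtain ⟨b, -, hb⟩ := (Nat.dvd_prime_pow hp).1
      (hcard ▸ Finset.dvd_prod_of_mem a (Finset.mem_univ i))
    exact ⟨b, hb⟩
  choose b hb using hpow
  obtain rfl : a = fun i ↦ p ^ b i := funext hb
  have hpos : ∀ i, 0 < b i := fun i ↦ Nat.pos_of_ne_zero fun h ↦ by simpa [h] using ha i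
  let s : Multiset ℕ := Finset.univ.val.map b
  let lam : PartitionsAll := ⟨s.sum, s, by simp [s, hpos], rfl⟩
  obtain ⟨σ, hσ⟩ := exists_equiv_of_map_univ_eq (f := b) (g := s.toList.get) (by
    rw [Fin.univ_val_map, List.ofFn_get, Multiset.coe_toList])
  have hb' : b = fun i ↦ s.toList.get (σ i) := funext fun i ↦ (hσ i).symm
  have : (∀ i, ZMod (p ^ b i)) ≃+ pGroup p lam := by
    rw [hb']
    exact (LinearEquiv.piCongrLeft ℤ (fun j ↦ ZMod (p ^ s.toList.get j)) σ).toAddEquiv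
  exact ⟨lam, ⟨f'.trans this⟩⟩

theorem card_surjective_addMonoidHom (A G : Type*) [AddCommGroup A] [AddCommGroup G] :
    Nat.card {φ : A →+ G // Function.Surjective φ} =
      Nat.card {H : AddSubgroup A // Nonempty (A ⧸ H ≃+ G)} * Nat.card (AddAut G) := by
  let f : {φ : A →+ G // Function.Surjective φ} → {H : AddSubgroup A // Nonempty (A ⧸ H ≃+ G)} :=
    fun φ ↦ ⟨φ.1.ker, ⟨QuotientAddGroup.quotientKerEquivOfSurjective φ.1 φ.2⟩⟩
  have hf (H : {H : AddSubgroup A // Nonempty (A ⧸ H ≃+ G)}) :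
      Nonempty ({φ // f φ = H} ≃ AddAut G) := by
    obtain ⟨H, ⟨e⟩⟩ := H
    let q : AddAut G → A →+ G := fun α ↦
      (α : G →+ G).comp ((e : A ⧸ H →+ G).comp (QuotientAddGroup.mk' H))
    have hq (α : AddAut G) (x : A) : q α x = α (e x) := rfl
    have hqs (α : AddAut G) : Function.Surjective (q α) :=
      α.surjective.comp (e.surjective.comp (QuotientAddGroup.mk'_surjective H))
    have hqk (α : AddAut G) : (q α).ker = H := by
      ext x
      rw [AddMonoidHom.mem_ker, hq]
      simp
    refine ⟨(Equiv.ofBijective (fun α ↦ ⟨⟨q α, hqs α⟩, Subtype.ext (hqk α)⟩) ⟨?_, ?_⟩).symm⟩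
    · intro α β h
      have h : q α = q β := by simpa using h
      ext g
      obtain ⟨y, rfl⟩ := e.surjective g
      obtain ⟨x, rfl⟩ := QuotientAddGroup.mk_surjective y
      exact DFunLike.congr_fun h x
    · rintro ⟨⟨φ, hφ⟩, h⟩
      obtain rfl : φ.ker = H := congrArg Subtype.val h
      refine ⟨e.symm.trans (QuotientAddGroup.quotientKerEquivOfSurjective φ hφ), ?_⟩
      refine Subtype.ext (Subtype.ext (AddMonoidHom.ext fun x ↦ ?_))
      simp only [hq]
      simp [AddEquiv.trans_apply]
      rfl
  rw [← Nat.card_prod, ← Nat.card_congr (Equiv.sigmaFiberEquiv f)]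
  exact Nat.card_congr ((Equiv.sigmaCongrRight fun H ↦ (hf H).some).trans
    (Equiv.sigmaEquivProd _ _))

/-- The probability that `k` uniformly random elements generate the finite group `G`. -/
noncomputable def genProb (G : Type*) [AddCommGroup G] (k : ℕ) : ℝ≥0∞ :=
  Nat.card {g : Fin k → G // Submodule.span ℤ (Set.range g) = ⊤} / (Nat.card G : ℝ≥0∞) ^ k

theorem genProb_mono (G : Type*) [AddCommGroup G] [Finite G] : Monotone (genProb G) := by
  refine monotone_nat_of_le_succ fun k ↦ ?_
  have hG : (Nat.card G : ℝ≥0∞) ≠ 0 := by exact_mod_cast Nat.card_pos.ne'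
  have h : Nat.card {g : Fin k → G // Submodule.span ℤ (Set.range g) = ⊤} * Nat.card G ≤
      Nat.card {g : Fin (k + 1) → G // Submodule.span ℤ (Set.range g) = ⊤} := by
    rw [← Nat.card_prod]
    refine Nat.card_le_card_of_injective
      (fun t ↦ ⟨Fin.cons t.2 t.1.1, top_unique ?_⟩) fun t t' h ↦ ?_
    · rw [Fin.range_cons]
      exact t.1.2.ge.trans (Submodule.span_mono (Set.subset_insert _ _))
    · have := Fin.cons_injective2 (Subtype.mk.inj h)
      exact Prod.ext (Subtype.ext this.2) this.1
  rw [genProb, genProb, pow_succ, ← ENNReal.mul_div_mul_right _ _ hG (by simp)]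
  gcongr
  exact_mod_cast h

theorem one_le_genProb_add (G : Type*) [AddCommGroup G] [Finite G] (k : ℕ) :
    1 ≤ genProb G k + Nat.card G * ((Nat.card G - 1 : ℕ) / Nat.card G : ℝ≥0∞) ^ k := by
  classical
  have := Fintype.ofFinite G
  have hG : (Nat.card G : ℝ≥0∞) ≠ 0 := by exact_mod_cast Nat.card_pos.ne'
  have hnot : (Finset.univ.filter fun g : Fin k → G ↦ ¬ Submodule.span ℤ (Set.range g) = ⊤) ⊆
      Finset.univ.biUnion fun a : G ↦ Fintype.piFinset fun _ ↦ Finset.univ.erase a := by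
    intro g hg
    simp only [Finset.mem_filter, Finset.mem_univ, true_and] at hg
    by_contra h
    refine hg (top_unique fun a _ ↦ Submodule.subset_span ?_)
    simp only [Finset.mem_biUnion, Fintype.mem_piFinset, Finset.mem_erase, Finset.mem_univ,
      true_and, and_true, not_exists, not_forall, not_not] at h
    exact h a
  have hle : Nat.card G ^ k ≤ Nat.card {g : Fin k → G // Submodule.span ℤ (Set.range g) = ⊤} +
      Nat.card G * (Nat.card G - 1) ^ k := by
    have h1 := Finset.card_filter_add_card_filter_not (s := (Finset.univ : Finset (Fin k → G)))
      fun g : Fin k → G ↦ Submodule.span ℤ (Set.range g) = ⊤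
    have h2 := (Finset.card_le_card hnot).trans Finset.card_biUnion_le
    simp only [Fintype.card_piFinset, Finset.card_erase_of_mem, Finset.mem_univ, Finset.card_univ,
      Finset.prod_const, Finset.sum_const, smul_eq_mul, Fintype.card_fin, Fintype.card_fun]
      at h1 h2
    rw [Nat.card_eq_fintype_card, Nat.card_eq_fintype_card, Fintype.card_subtype]
    omega
  have hle' : (Nat.card G : ℝ≥0∞) ^ k ≤
      Nat.card {g : Fin k → G // Submodule.span ℤ (Set.range g) = ⊤} +
      Nat.card G * ((Nat.card G - 1 : ℕ) : ℝ≥0∞) ^ k := by exact_mod_cast hle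
  calc (1 : ℝ≥0∞) = (Nat.card G : ℝ≥0∞) ^ k / (Nat.card G : ℝ≥0∞) ^ k :=
        (ENNReal.div_self (by simp) (by simp)).symm
    _ ≤ _ := ENNReal.div_le_div_right hle' _
    _ = _ := by
      rw [ENNReal.add_div, genProb, mul_div_assoc]
      simp only [div_eq_mul_inv, mul_pow, ENNReal.inv_pow]

theorem iSup_genProb (G : Type*) [AddCommGroup G] [Finite G] : ⨆ k, genProb G k = 1 := by
  have hG : (Nat.card G : ℝ≥0∞) ≠ 0 := by exact_mod_cast Nat.card_pos.ne'
  refine le_antisymm (iSup_le fun k ↦ ?_) ?_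
  · refine ENNReal.div_le_of_le_mul ?_
    rw [one_mul]
    have h := Nat.card_le_card_of_injective
      (Subtype.val : {g : Fin k → G // Submodule.span ℤ (Set.range g) = ⊤} → _)
      Subtype.val_injective
    rw [Nat.card_fun, Nat.card_fin] at h
    exact_mod_cast h
  · have h1 : Tendsto (genProb G) atTop (𝓝 (⨆ k, genProb G k)) :=
      tendsto_atTop_iSup (genProb_mono G)
    have hlt : ((Nat.card G - 1 : ℕ) / Nat.card G : ℝ≥0∞) < 1 := by
      refine ENNReal.div_lt_of_lt_mul ?_
      rw [one_mul]
      exact_mod_cast Nat.sub_lt Nat.card_pos one_pos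
    have h2 := ENNReal.Tendsto.const_mul (a := (Nat.card G : ℝ≥0∞))
      (ENNReal.tendsto_pow_atTop_nhds_zero_of_lt_one hlt) (Or.inr (by simp))
    have h3 := h1.add h2
    rw [mul_zero, add_zero] at h3
    exact ge_of_tendsto' h3 (one_le_genProb_add G)

/-- A homomorphism from `ℤᵏ` is given by the images of the standard basis. -/
noncomputable def homOfTuple (G : Type*) [AddCommGroup G] (k : ℕ) :
    (Fin k → G) ≃ ((Fin k → ℤ) →+ G) :=
  (((Pi.basisFun ℤ (Fin k)).constr ℤ).trans (addMonoidHomLequivInt ℤ).symm).toEquiv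

theorem card_surjective_eq_card_generating (G : Type*) [AddCommGroup G] (k : ℕ) :
    Nat.card {φ : (Fin k → ℤ) →+ G // Function.Surjective φ} =
      Nat.card {g : Fin k → G // Submodule.span ℤ (Set.range g) = ⊤} := by
  refine (Nat.card_congr ((homOfTuple G k).subtypeEquiv fun g ↦ ?_)).symm
  rw [← (Pi.basisFun ℤ (Fin k)).constr_range (S := ℤ), LinearMap.range_eq_top]
  rfl

theorem card_pGroup (p : ℕ) (lam : PartitionsAll) :
    ∃ n, Nat.card (pGroup p lam) = p ^ n := by
  refine ⟨∑ i : Fin lam.2.parts.toList.length, lam.2.parts.toList.get i, ?_⟩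
  rw [Nat.card_pi, ← Finset.prod_pow_eq_pow_sum]
  simp

theorem finite_pGroup {p : ℕ} (hp : p.Prime) (lam : PartitionsAll) : Finite (pGroup p lam) := by
  obtain ⟨n, hn⟩ := card_pGroup p lam
  exact Nat.finite_of_card_ne_zero (hn ▸ pow_ne_zero _ hp.ne_zero)

theorem finite_addAut (G : Type*) [AddCommGroup G] [Finite G] : Finite (AddAut G) :=
  Finite.of_injective (fun e : AddAut G ↦ (e : G → G)) DFunLike.coe_injective

theorem subgroupZeta_eq_tsum_genProb {p : ℕ} (hp : p.Prime) (k : ℕ) :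
    subgroupZeta (Fin k → ℤ) p k = ∑' lam : PartitionsAll,
      genProb (pGroup p lam) k * (Nat.card (AddAut (pGroup p lam)) : ℝ≥0∞)⁻¹ := by
  have hex (H : PPowSubgroup (Fin k → ℤ) p) :
      ∃ lam : PartitionsAll, Nonempty (((Fin k → ℤ) ⧸ H.1) ≃+ pGroup p lam) := by
    obtain ⟨H, n, hn⟩ := H
    exact exists_pGroup_addEquiv hp _ hn
  choose cls hcls using hex
  have hiff (H : PPowSubgroup (Fin k → ℤ) p) (lam : PartitionsAll) :
      cls H = lam ↔ Nonempty (((Fin k → ℤ) ⧸ H.1) ≃+ pGroup p lam) := by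
    constructor
    · rintro rfl
      exact hcls H
    · rintro ⟨e⟩
      obtain ⟨e'⟩ := hcls H
      exact eq_of_pGroup_addEquiv hp (e'.symm.trans e)
  rw [subgroupZeta, ← (Equiv.sigmaFiberEquiv cls).tsum_eq, ENNReal.tsum_sigma']
  refine tsum_congr fun lam ↦ ?_
  have := finite_pGroup hp lam
  have := finite_addAut (pGroup p lam)
  have hG : (Nat.card (pGroup p lam) : ℝ≥0∞) ≠ 0 := by exact_mod_cast Nat.card_pos.ne'
  have hA : (Nat.card (AddAut (pGroup p lam)) : ℝ≥0∞) ≠ 0 := by exact_mod_cast Nat.card_pos.ne'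
  let e : {H // cls H = lam} ≃
      {H : AddSubgroup (Fin k → ℤ) // Nonempty (((Fin k → ℤ) ⧸ H) ≃+ pGroup p lam)} :=
    { toFun := fun H ↦ ⟨H.1.1, (hiff _ _).1 H.2⟩
      invFun := fun H ↦ ⟨⟨H.1, by
        obtain ⟨n, hn⟩ := card_pGroup p lam
        exact ⟨n, by rw [← hn]; exact Nat.card_congr H.2.some.toEquiv⟩⟩, (hiff _ _).2 H.2⟩
      left_inv := fun _ ↦ rfl
      right_inv := fun _ ↦ rfl }
  have hidx (H : {H // cls H = lam}) : H.1.1.index = Nat.card (pGroup p lam) :=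
    Nat.card_congr ((hiff _ _).1 H.2).some.toEquiv
  have hcard := (card_surjective_eq_card_generating (pGroup p lam) k).symm.trans
    (card_surjective_addMonoidHom (Fin k → ℤ) (pGroup p lam))
  have hfin : Finite {H // cls H = lam} := by
    have : Finite ((Fin k → ℤ) →+ pGroup p lam) := Finite.of_equiv _ (homOfTuple _ k)
    let f (H : {H // cls H = lam}) : (Fin k → ℤ) →+ pGroup p lam :=
      (((hiff _ _).1 H.2).some : _ →+ pGroup p lam).comp (QuotientAddGroup.mk' H.1.1)
    have hf (H) : (f H).ker = H.1.1 := by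
      ext x
      simp [f]
    refine Finite.of_injective f fun H H' h ↦ Subtype.ext (Subtype.ext ?_)
    rw [← hf, ← hf, h]
  simp only [Equiv.sigmaFiberEquiv_apply, hidx]
  rw [ENNReal.tsum_const, ENat.card_eq_coe_natCard, Nat.card_congr e, genProb, hcard,
    Nat.cast_mul, ENat.toENNReal_coe, div_eq_mul_inv, mul_assoc, mul_assoc,
    mul_comm (_)⁻¹ (_)⁻¹, ← mul_assoc (Nat.card (AddAut _) : ℝ≥0∞),
    ENNReal.mul_inv_cancel hA (by simp), one_mul]

theorem tsum_inv_card_addAut {p : ℕ} (hp : p.Prime) :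
    ∑' lam : PartitionsAll, (Nat.card (AddAut (pGroup p lam)) : ℝ≥0∞)⁻¹ =
      ⨆ k, ∏ i ∈ Finset.range k, (1 - ((p : ℝ≥0∞)⁻¹) ^ (i + 1))⁻¹ := by
  let _ : MeasurableSpace PartitionsAll := ⊤
  simp only [← subgroupZeta_fin hp, subgroupZeta_eq_tsum_genProb hp]
  simp only [← MeasureTheory.lintegral_count]
  rw [← MeasureTheory.lintegral_iSup (fun _ ↦ measurable_from_top)]
  · refine MeasureTheory.lintegral_congr fun lam ↦ ?_
    have := finite_pGroup hp lam
    rw [← ENNReal.iSup_mul, iSup_genProb, one_mul]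
  · intro k l hkl lam
    have := finite_pGroup hp lam
    exact mul_le_mul_left (genProb_mono _ hkl) _

theorem one_sub_le_prod_one_sub_pow {x : ℝ} (h0 : 0 ≤ x) (h1 : x < 1) (k : ℕ) :
    1 - x ^ 2 / (1 - x) ≤ ∏ i ∈ Finset.range k, (1 - x ^ (i + 2)) := by
  have h1' : 0 < 1 - x := sub_pos.2 h1
  have hsum : ∀ k : ℕ, ∑ i ∈ Finset.range k, x ^ (i + 2) ≤ x ^ 2 / (1 - x) := by
    intro k
    rw [le_div_iff₀ h1', Finset.sum_congr rfl fun i _ ↦ pow_add x i 2, ← Finset.sum_mul,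
      mul_right_comm, geom_sum_mul_neg]
    nlinarith [pow_nonneg h0 k, pow_nonneg h0 2, mul_nonneg (pow_nonneg h0 k) (pow_nonneg h0 2)]
  have hprod : 1 - ∑ i ∈ Finset.range k, x ^ (i + 2) ≤
      ∏ i ∈ Finset.range k, (1 - x ^ (i + 2)) := by
    induction k with
    | zero => simp
    | succ k ih =>
      rw [Finset.sum_range_succ, Finset.prod_range_succ]
      have hx : x ^ (k + 2) ≤ 1 := pow_le_one₀ h0 h1.le
      have hx0 : 0 ≤ x ^ (k + 2) := pow_nonneg h0 _
      have hs : 0 ≤ ∑ i ∈ Finset.range k, x ^ (i + 2) :=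
        Finset.sum_nonneg fun i _ ↦ pow_nonneg h0 _
      nlinarith [mul_le_mul_of_nonneg_right ih (sub_nonneg.2 hx), mul_nonneg hs hx0]
  linarith [hsum k]

theorem inv_prime_pos {p : ℕ} (hp : p.Prime) : 0 < (p : ℝ)⁻¹ :=
  inv_pos.2 (by exact_mod_cast hp.pos)

theorem inv_prime_le_half {p : ℕ} (hp : p.Prime) : (p : ℝ)⁻¹ ≤ 1 / 2 := by
  rw [one_div]
  exact inv_anti₀ two_pos (by exact_mod_cast hp.two_le)

theorem tendsto_prod_clC {p : ℕ} (hp : p.Prime) :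
    Tendsto (fun k ↦ ∏ i ∈ Finset.range k, (1 - (p : ℝ)⁻¹ ^ (i + 1))) atTop (𝓝 (clC p)) := by
  have hs : Summable fun i : ℕ ↦ -(p : ℝ)⁻¹ ^ (i + 1) :=
    ((summable_nat_add_iff 1).2 (summable_geometric_of_lt_one (inv_prime_pos hp).le
      ((inv_prime_le_half hp).trans_lt (by norm_num)))).neg
  have := (Real.multipliable_one_add_of_summable hs).hasProd.tendsto_prod_nat
  simpa only [clC, sub_eq_add_neg] using this

theorem le_clC {p : ℕ} (hp : p.Prime) :
    (1 - (p : ℝ)⁻¹) * (1 - (p : ℝ)⁻¹ ^ 2 / (1 - (p : ℝ)⁻¹)) ≤ clC p := by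
  have h1 : (p : ℝ)⁻¹ < 1 := (inv_prime_le_half hp).trans_lt (by norm_num)
  refine ge_of_tendsto ((tendsto_add_atTop_iff_nat 1).2 (tendsto_prod_clC hp))
    (Eventually.of_forall fun k ↦ ?_)
  rw [Finset.prod_range_succ', mul_comm, zero_add, pow_one]
  exact mul_le_mul_of_nonneg_right
    (one_sub_le_prod_one_sub_pow (inv_prime_pos hp).le h1 k) (sub_pos.2 h1).le

theorem quarter_le_clC {p : ℕ} (hp : p.Prime) : 1 / 4 ≤ clC p := by
  refine le_trans ?_ (le_clC hp)
  have h0 := inv_prime_pos hp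
  have h1 := inv_prime_le_half hp
  have h2 : 1 - (p : ℝ)⁻¹ ≠ 0 := by linarith
  rw [mul_sub, mul_div_cancel₀ _ h2]
  nlinarith

theorem clC_pos {p : ℕ} (hp : p.Prime) : 0 < clC p :=
  lt_of_lt_of_le (by norm_num) (quarter_le_clC hp)

/-- The Cohen–Lenstra (Hall) identity. -/
theorem tsum_inv_card_addAut_eq {p : ℕ} (hp : p.Prime) :
    ∑' lam : PartitionsAll, (Nat.card (AddAut (pGroup p lam)) : ℝ≥0∞)⁻¹ =
      ENNReal.ofReal (clC p)⁻¹ := by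
  have h0 := inv_prime_pos hp
  have h1 : (p : ℝ)⁻¹ < 1 := (inv_prime_le_half hp).trans_lt (by norm_num)
  have hfac (i : ℕ) : 0 < 1 - (p : ℝ)⁻¹ ^ (i + 1) :=
    sub_pos.2 (pow_lt_one₀ h0.le h1 i.succ_ne_zero)
  have hprod (k : ℕ) : ∏ i ∈ Finset.range k, (1 - ((p : ℝ≥0∞)⁻¹) ^ (i + 1))⁻¹ =
      ENNReal.ofReal (∏ i ∈ Finset.range k, (1 - (p : ℝ)⁻¹ ^ (i + 1)))⁻¹ := by
    rw [← Finset.prod_inv_distrib, ENNReal.ofReal_prod_of_nonneg fun i _ ↦ (inv_pos.2 (hfac i)).le]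
    refine Finset.prod_congr rfl fun i _ ↦ ?_
    rw [ENNReal.ofReal_inv_of_pos (hfac i), ENNReal.ofReal_sub _ (pow_nonneg h0.le _),
      ENNReal.ofReal_pow h0.le, ENNReal.ofReal_inv_of_pos (by exact_mod_cast hp.pos)]
    simp
  rw [tsum_inv_card_addAut hp]
  refine tendsto_nhds_unique (tendsto_atTop_iSup ?_) ?_
  · refine monotone_nat_of_le_succ fun k ↦ ?_
    rw [Finset.prod_range_succ]
    exact le_mul_of_one_le_right' (ENNReal.one_le_inv.2 tsub_le_self)
  · simp only [hprod]
    exact ENNReal.tendsto_ofReal ((tendsto_prod_clC hp).inv₀ (clC_pos hp).ne')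

instance : MeasurableSpace PartitionsAll := ⊤

instance : MeasurableSingletonClass PartitionsAll := ⟨fun _ ↦ trivial⟩

instance : Countable PartitionsAll := inferInstanceAs (Countable (Σ n : ℕ, Nat.Partition n))

/-- The local Cohen–Lenstra distribution. -/
noncomputable def localPMF (p : Nat.Primes) : PMF PartitionsAll :=
  ⟨fun lam ↦ (Nat.card (AddAut (pGroup p lam)) : ℝ≥0∞)⁻¹ * ENNReal.ofReal (clC p), by
    have h : ∑' lam : PartitionsAll, (Nat.card (AddAut (pGroup p lam)) : ℝ≥0∞)⁻¹ *
        ENNReal.ofReal (clC p) = 1 := by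
      rw [ENNReal.tsum_mul_right, tsum_inv_card_addAut_eq p.2,
        ← ENNReal.ofReal_mul (inv_pos.2 (clC_pos p.2)).le, inv_mul_cancel₀ (clC_pos p.2).ne',
        ENNReal.ofReal_one]
    exact h ▸ ENNReal.summable.hasSum⟩

theorem toReal_localPMF_toMeasure (p : Nat.Primes) (S : Set PartitionsAll) :
    ((localPMF p).toMeasure S).toReal = Pp p S := by
  rw [PMF.toMeasure_apply _ .of_discrete, ← tsum_subtype]
  change (∑' lam : S, (Nat.card (AddAut (pGroup p lam)) : ℝ≥0∞)⁻¹ *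
    ENNReal.ofReal (clC p)).toReal = _
  rw [ENNReal.tsum_mul_right, ENNReal.toReal_mul, ENNReal.toReal_ofReal (clC_pos p.2).le, Pp,
    ENNReal.tsum_toReal_eq]
  · simp [wCL]
  · intro lam
    have := finite_pGroup p.2 lam
    have := finite_addAut (pGroup p lam)
    simp [Nat.card_pos.ne']

theorem wCL_zero (p : ℕ) : wCL p 0 = 1 := by
  have hl : (0 : PartitionsAll).2.parts.toList.length = 0 := by
    rw [Multiset.length_toList]; rfl
  have : IsEmpty (Fin (0 : PartitionsAll).2.parts.toList.length) := by
    rw [hl]; infer_instance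
  have : Unique (AddAut (pGroup p 0)) :=
    ⟨⟨AddEquiv.refl _⟩, fun e ↦ AddEquiv.ext fun x ↦ Subsingleton.elim _ _⟩
  rw [wCL, Nat.card_unique]
  simp

theorem wCL_partOne {p : ℕ} (hp : p.Prime) : wCL p partOne = ((p : ℝ) - 1)⁻¹ := by
  have hl : partOne.2.parts.toList = [1] := Multiset.toList_singleton 1
  have key : ∀ l : List ℕ, l = [1] →
      Nat.card (AddAut (∀ i : Fin l.length, ZMod (p ^ l.get i))) = p - 1 := by
    rintro _ rfl
    let _ : Unique (Fin [1].length) := inferInstanceAs (Unique (Fin 1))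
    let e : (∀ i : Fin [1].length, ZMod (p ^ [1].get i)) ≃+ ZMod (p ^ 1) :=
      (LinearEquiv.piUnique ℤ (fun i : Fin [1].length ↦ ZMod (p ^ [1].get i))).toAddEquiv
    have : NeZero (p ^ 1) := ⟨pow_ne_zero _ hp.ne_zero⟩
    rw [Nat.card_congr (AddAut.congr e).toEquiv,
      Nat.card_congr (ZMod.AddAutEquivUnits (p ^ 1)).toEquiv]
    change Nat.card (ZMod (p ^ 1))ˣ = _
    rw [Nat.card_eq_fintype_card, ZMod.card_units_eq_totient, pow_one, Nat.totient_prime hp]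
  rw [wCL, key _ hl, Nat.cast_sub hp.one_le, Nat.cast_one]

theorem localPMF_compl_zero_le (p : Nat.Primes) :
    (localPMF p).toMeasure {0}ᶜ ≤ ENNReal.ofReal (3 / 4) := by
  have h : ((localPMF p).toMeasure {0}).toReal = clC p := by
    rw [toReal_localPMF_toMeasure, Pp, tsum_fintype]
    simp [wCL_zero]
  rw [MeasureTheory.prob_compl_eq_one_sub (MeasurableSet.singleton _),
    ← ENNReal.ofReal_toReal (MeasureTheory.measure_ne_top (localPMF p).toMeasure {0}), h,
    ← ENNReal.ofReal_one, ← ENNReal.ofReal_sub _ (clC_pos p.2).le]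
  exact ENNReal.ofReal_le_ofReal (by linarith [quarter_le_clC p.2])

theorem localPMF_compl_zero_one_le (p : Nat.Primes) :
    (localPMF p).toMeasure {0, partOne}ᶜ ≤ ENNReal.ofReal (2 * ((p : ℕ) : ℝ)⁻¹ ^ 2) := by
  have hne : (0 : PartitionsAll) ≠ partOne := fun h ↦ zero_ne_one (congrArg Sigma.fst h)
  have h0 := inv_prime_pos p.2
  have h1 := inv_prime_le_half p.2
  have hp0 : ((p : ℕ) : ℝ) ≠ 0 := by exact_mod_cast p.2.ne_zero
  have hp1 : (1 : ℝ) < (p : ℕ) := by exact_mod_cast p.2.one_lt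
  have h : ((localPMF p).toMeasure {0, partOne}).toReal =
      clC p / (1 - ((p : ℕ) : ℝ)⁻¹) := by
    rw [Set.insert_eq, MeasureTheory.measure_union (by simpa using hne)
      (MeasurableSet.singleton _), ENNReal.toReal_add (by finiteness) (by finiteness),
      toReal_localPMF_toMeasure, toReal_localPMF_toMeasure, Pp, Pp, tsum_fintype, tsum_fintype]
    have h2 : ((p : ℕ) : ℝ) - 1 ≠ 0 := by linarith
    simp only [Finset.univ_unique, Set.default_coe_singleton, Finset.sum_singleton, wCL_zero,
      wCL_partOne p.2]
    field_simp
    ring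
  have hle : 1 - 2 * ((p : ℕ) : ℝ)⁻¹ ^ 2 ≤ clC p / (1 - ((p : ℕ) : ℝ)⁻¹) := by
    have h2 : 0 < 1 - ((p : ℕ) : ℝ)⁻¹ := by linarith
    have h3 : ((p : ℕ) : ℝ)⁻¹ ^ 2 / (1 - ((p : ℕ) : ℝ)⁻¹) ≤ 2 * ((p : ℕ) : ℝ)⁻¹ ^ 2 := by
      rw [div_le_iff₀ h2]
      nlinarith [pow_pos h0 2]
    rw [le_div_iff₀ h2, mul_comm]
    exact (mul_le_mul_of_nonneg_left (by linarith) h2.le).trans (le_clC p.2)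
  rw [MeasureTheory.prob_compl_eq_one_sub MeasurableSet.of_discrete,
    ← ENNReal.ofReal_toReal (MeasureTheory.measure_ne_top (localPMF p).toMeasure {0, partOne}), h,
    ← ENNReal.ofReal_one, ← ENNReal.ofReal_sub _ (by rw [← h]; exact ENNReal.toReal_nonneg)]
  exact ENNReal.ofReal_le_ofReal (by linarith)

open MeasureTheory

/-- The product of the local Cohen–Lenstra distributions. -/
noncomputable def productMeasureCL : Measure (Nat.Primes → PartitionsAll) :=
  Measure.infinitePi fun p ↦ (localPMF p).toMeasure

instance : IsProbabilityMeasure productMeasureCL :=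
  inferInstanceAs (IsProbabilityMeasure (Measure.infinitePi fun p ↦ (localPMF p).toMeasure))

theorem ae_exists_eq_zero : ∀ᵐ ω ∂productMeasureCL, ∃ p, ω p = 0 := by
  rw [ae_iff, ← nonpos_iff_eq_zero]
  have hlt : ENNReal.ofReal (3 / 4) < 1 := by
    rw [← ENNReal.ofReal_one, ENNReal.ofReal_lt_ofReal_iff one_pos]; norm_num
  refine ge_of_tendsto' (ENNReal.tendsto_pow_atTop_nhds_zero_of_lt_one hlt) fun n ↦ ?_
  obtain ⟨s, hs⟩ := Infinite.exists_subset_card_eq Nat.Primes n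
  calc productMeasureCL {ω | ¬ ∃ p, ω p = 0}
      ≤ productMeasureCL (Set.pi s fun _ ↦ {0}ᶜ) :=
        measure_mono fun ω hω p _ h ↦ hω ⟨p, h⟩
    _ = ∏ p ∈ s, (localPMF p).toMeasure {0}ᶜ := Measure.infinitePi_pi _ fun _ _ ↦ MeasurableSet.of_discrete
    _ ≤ ∏ p ∈ s, ENNReal.ofReal (3 / 4) :=
        Finset.prod_le_prod' fun p _ ↦ localPMF_compl_zero_le p
    _ = ENNReal.ofReal (3 / 4) ^ n := by rw [Finset.prod_const, hs]

theorem ae_finite_range : ∀ᵐ ω ∂productMeasureCL, (Set.range ω).Finite := by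
  have hsum : ∑' p : Nat.Primes, productMeasureCL {ω | ω p ∈ ({0, partOne}ᶜ : Set _)} ≠ ∞ := by
    have hle (p : Nat.Primes) : productMeasureCL {ω | ω p ∈ ({0, partOne}ᶜ : Set _)} ≤
        ENNReal.ofReal (2 * ((p : ℕ) : ℝ)⁻¹ ^ 2) := by
      refine le_trans (le_of_eq ?_) (localPMF_compl_zero_one_le p)
      have := Measure.infinitePi_pi (fun p : Nat.Primes ↦ (localPMF p).toMeasure) (s := {p})
        (t := fun _ ↦ {0, partOne}ᶜ) fun _ _ ↦ MeasurableSet.of_discrete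
      rw [Finset.prod_singleton] at this
      rw [← this, productMeasureCL]
      congr 1
      ext ω
      simp
    have hs : Summable fun p : Nat.Primes ↦ 2 * ((p : ℕ) : ℝ)⁻¹ ^ 2 := by
      have : Summable fun n : ℕ ↦ 2 * (n : ℝ)⁻¹ ^ 2 := by
        simpa using (Real.summable_nat_pow_inv.2 one_lt_two).mul_left 2
      exact this.subtype _
    refine ne_top_of_le_ne_top ?_ (ENNReal.tsum_le_tsum hle)
    rw [← ENNReal.ofReal_tsum_of_nonneg (fun p ↦ by positivity) hs]
    exact ENNReal.ofReal_ne_top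
  filter_upwards [ae_finite_setOfPred_mem hsum] with ω hω
  refine ((Set.toFinite {0, partOne}).union (hω.image ω)).subset ?_
  rintro _ ⟨p, rfl⟩
  by_cases h : ω p ∈ ({0, partOne} : Set PartitionsAll)
  · exact Or.inl h
  · exact Or.inr ⟨p, h, rfl⟩

theorem exists_finsupp_forall_mem_iff {ι M : Type*} [Zero M] {f : ι → M} (h0 : ∃ i, f i = 0)
    (hf : (Set.range f).Finite) :
    ∃ g : ι →₀ M, ∀ S : Set M, (∀ i, g i ∈ S) ↔ ∀ i, f i ∈ S := by
  classical
  have : Nonempty ι := h0.nonempty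
  choose! i hi using fun (m : M) (hm : m ∈ Set.range f) ↦ hm
  let s : Finset ι := hf.toFinset.image i
  refine ⟨Finsupp.indicator s fun j _ ↦ f j, fun S ↦ ⟨fun h j ↦ ?_, fun h j ↦ ?_⟩⟩
  · have hj : i (f j) ∈ s := Finset.mem_image_of_mem _ (by simp)
    have := h (i (f j))
    rwa [Finsupp.indicator_of_mem hj, hi _ ⟨j, rfl⟩] at this
  · by_cases hj : j ∈ s
    · rw [Finsupp.indicator_of_mem hj]
      exact h j
    · rw [Finsupp.indicator_of_notMem hj]
      obtain ⟨k, hk⟩ := h0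
      exact hk ▸ h k

theorem productMeasureCL_pi_eq {S : Set PartitionsAll} {L : ℝ}
    (h : Tendsto (globPartial S) atTop (𝓝 L)) :
    productMeasureCL (Set.pi Set.univ fun _ ↦ S) = ENNReal.ofReal L := by
  let s (n : ℕ) : Finset Nat.Primes := (primesUpTo n).subtype Nat.Prime
  have hs {n : ℕ} {p : Nat.Primes} : p ∈ s n ↔ (p : ℕ) ≤ n :=
    Finset.mem_subtype.trans ⟨fun h ↦ Nat.lt_succ_iff.1 (Nat.mem_primesBelow.1 h).1,
      fun h ↦ Nat.mem_primesBelow.2 ⟨Nat.lt_succ_iff.2 h, p.2⟩⟩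
  let B (n : ℕ) : Set (Nat.Primes → PartitionsAll) := Set.pi (s n) fun _ ↦ S
  have hB (n : ℕ) : productMeasureCL (B n) = ENNReal.ofReal (globPartial S n) := by
    have h1 : globPartial S n = ∏ p ∈ s n, Pp p S :=
      (Finset.prod_subtype_of_mem (Pp · S) fun p hp ↦ (Nat.mem_primesBelow.1 hp).2).symm
    rw [h1, ← Finset.prod_congr rfl fun p _ ↦ toReal_localPMF_toMeasure p S,
      ← ENNReal.toReal_prod, ENNReal.ofReal_toReal (ENNReal.prod_ne_top fun p _ ↦ by finiteness)]
    exact Measure.infinitePi_pi _ fun _ _ ↦ MeasurableSet.of_discrete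
  have hpi : (Set.pi Set.univ fun _ ↦ S) = ⋂ n, B n := by
    ext ω
    simp only [Set.mem_iInter, B, Set.mem_pi, Finset.mem_coe, hs]
    exact ⟨fun h n p _ ↦ h p (Set.mem_univ p), fun h p _ ↦ h p p le_rfl⟩
  have hlim : Tendsto (fun n ↦ productMeasureCL (B n)) atTop
      (𝓝 (productMeasureCL (⋂ n, B n))) := by
    refine tendsto_measure_iInter_atTop (fun n ↦ ?_) (fun m n hmn ω hω p hp ↦ ?_)
      ⟨0, measure_ne_top _ _⟩
    · exact (MeasurableSet.pi (Finset.countable_toSet _) fun _ _ ↦ MeasurableSet.of_discrete).nullMeasurableSet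
    · exact hω p (Finset.mem_coe.2 (hs.2 ((hs.1 hp).trans hmn)))
  rw [hpi]
  simp only [hB] at hlim
  exact tendsto_nhds_unique hlim (ENNReal.tendsto_ofReal h)

/-- The global Cohen–Lenstra probability measure exists: there is a countably additive
probability measure on the σ-algebra generated by the uniform properties assigning to
each `O(S)` the value `lim_{x→∞} ∏_{p ≤ x} P_p(S)`. -/
theorem global_CL_measure_exists :
    ∃ μ : @MeasureTheory.Measure GG glSigma,
      @MeasureTheory.IsProbabilityMeasure GG glSigma μ ∧
      ∀ (S : Set PartitionsAll) (L : ℝ),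
        Filter.Tendsto (globPartial S) Filter.atTop (nhds L) →
        μ (Oset S) = ENNReal.ofReal L := by
  have hex (ω : Nat.Primes → PartitionsAll) : ∃ G : GG, (∃ p, ω p = 0) → (Set.range ω).Finite →
      ∀ S : Set PartitionsAll, (∀ p, G p ∈ S) ↔ ∀ p, ω p ∈ S := by
    by_cases h : (∃ p, ω p = 0) ∧ (Set.range ω).Finite
    · obtain ⟨G, hG⟩ := exists_finsupp_forall_mem_iff h.1 h.2
      exact ⟨G, fun _ _ ↦ hG⟩
    · exact ⟨0, fun h0 h1 ↦ absurd ⟨h0, h1⟩ h⟩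
  choose Φ hΦ using hex
  have hae (S : Set PartitionsAll) :
      (Φ ⁻¹' Oset S) =ᵐ[productMeasureCL] Set.pi Set.univ fun _ ↦ S := by
    rw [Filter.eventuallyEq_set]
    filter_upwards [ae_exists_eq_zero, ae_finite_range] with ω h0 h1
    exact (hΦ ω h0 h1 S).trans (Set.mem_univ_pi (t := fun _ ↦ S)).symm
  have hΦm : @Measurable (NullMeasurableSpace (Nat.Primes → PartitionsAll) productMeasureCL) GG
      _ glSigma Φ := by
    refine measurable_generateFrom ?_
    rintro _ ⟨S, rfl⟩
    exact (MeasurableSet.univ_pi fun _ ↦ MeasurableSet.of_discrete).nullMeasurableSet.congr (hae S).symm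
  have huniv : productMeasureCL.completion Set.univ = 1 :=
    (Measure.completion_apply productMeasureCL Set.univ).trans measure_univ
  let _ : MeasurableSpace GG := glSigma
  let X := NullMeasurableSpace (Nat.Primes → PartitionsAll) productMeasureCL
  let ν : Measure X := productMeasureCL.completion
  have : IsProbabilityMeasure ν := ⟨huniv⟩
  let Ψ : X → GG := Φ
  have hΨ : Measurable Ψ := hΦm
  refine ⟨ν.map Ψ, Measure.isProbabilityMeasure_map hΨ.aemeasurable, fun S L h ↦ ?_⟩
  rw [Measure.map_apply hΨ (MeasurableSpace.measurableSet_generateFrom ⟨S, rfl⟩)]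
  exact (Measure.completion_apply productMeasureCL _).trans
    ((measure_congr (hae S)).trans (productMeasureCL_pi_eq h))
end

section
/- Let D₀, D₁, …, D_n ∈ 𝔇 be such that D₀ ⊆ ⋃_{i=1}^n D_i. Then P(D₀) ≤ ∑_{i=1}^n P(D_i). -/
open Filter Topology

/-- The automorphism `x ↦ y` with `y_m = u x_m` and `y_j = x_j + c_j x_m` for `j ≠ m`. -/
def transvectionAut {ι : Type*} [DecidableEq ι] {p : ℕ} {a : ι → ℕ} (m : ι)
    (hm : ∀ j, a j ≤ a m) (u : (ZMod (p ^ a m))ˣ)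
    (c : ∀ j : {j // j ≠ m}, ZMod (p ^ a j)) : AddAut (∀ i, ZMod (p ^ a i)) where
  toFun x j := if h : j = m then h ▸ (u * x m) else
    x j + c ⟨j, h⟩ * ZMod.castHom (pow_dvd_pow p (hm j)) (ZMod (p ^ a j)) (x m)
  invFun y j := if h : j = m then h ▸ ((u⁻¹ : (ZMod (p ^ a m))ˣ) * y m) else
    y j - c ⟨j, h⟩ * ZMod.castHom (pow_dvd_pow p (hm j)) (ZMod (p ^ a j))
      ((u⁻¹ : (ZMod (p ^ a m))ˣ) * y m)
  left_inv x := by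
    funext j
    by_cases h : j = m
    · subst h; simp
    · simp [h]
  right_inv y := by
    funext j
    by_cases h : j = m
    · subst h; simp
    · simp [h]
  map_add' x y := by
    funext j
    by_cases h : j = m
    · subst h; simp [mul_add]
    · simp only [h, dite_false, Pi.add_apply, map_add]; ring

theorem transvectionAut_injective {ι : Type*} [DecidableEq ι] {p : ℕ} {a : ι → ℕ} (m : ι)
    (hm : ∀ j, a j ≤ a m) :
    Function.Injective fun v : (ZMod (p ^ a m))ˣ × (∀ j : {j // j ≠ m}, ZMod (p ^ a j)) =>
      transvectionAut m hm v.1 v.2 := by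
  rintro ⟨u, c⟩ ⟨u', c'⟩ huc
  have key : ∀ j, transvectionAut m hm u c (Pi.single m 1) j =
      transvectionAut m hm u' c' (Pi.single m 1) j :=
    fun j => congrFun (DFunLike.congr_fun huc _) j
  refine Prod.ext (Units.ext ?_) (funext fun j => ?_)
  · simpa [transvectionAut] using key m
  · have := key j
    simpa only [transvectionAut, AddEquiv.coe_mk, Equiv.coe_fn_mk, j.2, dite_false,
      Pi.single_eq_same, map_one, mul_one, add_right_inj] using this

theorem pow_sum_mul_le_card_addAut {ι : Type*} [Fintype ι] [DecidableEq ι] {p : ℕ}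
    (hp : p.Prime) {a : ι → ℕ} (ha : ∀ i, 0 < a i) [Nonempty ι] :
    p ^ (∑ i, a i) * (p - 1) ≤ p * Nat.card (AddAut (∀ i, ZMod (p ^ a i))) := by
  obtain ⟨m, hm⟩ := Finite.exists_max a
  have : ∀ i, NeZero (p ^ a i) := fun i => ⟨pow_ne_zero _ hp.ne_zero⟩
  have : Finite (AddAut (∀ i, ZMod (p ^ a i))) := Finite.of_injective _ DFunLike.coe_injective
  have hle := Nat.card_le_card_of_injective _ (transvectionAut_injective (p := p) m hm)
  rw [Nat.card_prod, Nat.card_eq_fintype_card, ZMod.card_units_eq_totient,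
    Nat.totient_prime_pow hp (ha m), Nat.card_pi] at hle
  simp only [Nat.card_zmod] at hle
  rw [Finset.prod_pow_eq_pow_sum] at hle
  have hsum : ∑ i, a i = a m + ∑ i : {j // j ≠ m}, a i := by
    rw [← Finset.add_sum_erase _ _ (Finset.mem_univ m)]
    congr 1
    exact (Finset.sum_subtype _ (by simp) a)
  calc p ^ (∑ i, a i) * (p - 1)
      = p * (p ^ (a m - 1) * (p - 1) * p ^ ∑ i : {j // j ≠ m}, a i) := by
        rw [hsum, pow_add, ← Nat.sub_add_cancel (ha m)]
        simp only [Nat.add_sub_cancel, pow_succ]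
        ring
    _ ≤ _ := Nat.mul_le_mul_left _ hle

theorem PartitionsAll.eq_of_parts_eq {l m : PartitionsAll} (h : l.2.parts = m.2.parts) :
    l = m := by
  obtain ⟨n, l⟩ := l
  obtain ⟨k, m⟩ := m
  obtain rfl : n = k := by rw [← l.parts_sum, ← m.parts_sum, h]
  exact congrArg _ (Nat.Partition.ext h)

theorem PartitionsAll.eq_zero_of_size {l : PartitionsAll} (h : l.1 = 0) : l = 0 := by
  obtain ⟨n, l⟩ := l
  obtain rfl : n = 0 := h
  exact PartitionsAll.eq_of_parts_eq (l.partition_zero_parts)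

theorem PartitionsAll.eq_partOne_of_size {l : PartitionsAll} (h : l.1 = 1) : l = partOne := by
  obtain ⟨n, l⟩ := l
  obtain rfl : n = 1 := h
  exact PartitionsAll.eq_of_parts_eq (l.partition_one_parts)

theorem wCL_nonneg (p : ℕ) (l : PartitionsAll) : 0 ≤ wCL p l := by
  unfold wCL; positivity

theorem wCL_le_one (p : ℕ) (l : PartitionsAll) : wCL p l ≤ 1 :=
  Nat.cast_inv_le_one _

theorem wCL_le {p : ℕ} (hp : p.Prime) {l : PartitionsAll} (hl : l.1 ≠ 0) :
    wCL p l ≤ (p / (p - 1) : ℝ) * ((p : ℝ)⁻¹) ^ l.1 := by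
  have hsum : ∑ i : Fin l.2.parts.toList.length, l.2.parts.toList.get i = l.1 := by
    have h := l.2.parts_sum
    rw [← Multiset.coe_toList l.2.parts, Multiset.sum_coe] at h
    refine Eq.trans ?_ h
    rw [← List.sum_ofFn, List.ofFn_get]
  have : Nonempty (Fin l.2.parts.toList.length) := by
    by_contra hc
    rw [not_nonempty_iff] at hc
    exact hl (by rw [← hsum]; simp)
  have h := pow_sum_mul_le_card_addAut hp (a := fun i => l.2.parts.toList.get i)
    (fun i => l.2.parts_pos (Multiset.mem_toList.1 (List.get_mem _ i)))
  rw [hsum] at h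
  have hp1 : (1 : ℝ) < p := by exact_mod_cast hp.one_lt
  have hR : (p : ℝ) ^ l.1 * (p - 1) ≤ p * Nat.card (AddAut (pGroup p l)) := by
    have := (Nat.cast_le (α := ℝ)).2 h
    push_cast [Nat.cast_sub hp.one_lt.le] at this
    exact this
  have hpos : (0 : ℝ) < (p : ℝ) ^ l.1 * (p - 1) := by
    have : (0 : ℝ) < p - 1 := by linarith
    positivity
  have hcard : (0 : ℝ) < Nat.card (AddAut (pGroup p l)) := by
    have := hpos.trans_le hR
    exact pos_of_mul_pos_right this (by linarith)
  unfold wCL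
  rw [inv_pow, ← div_eq_mul_inv, div_div, inv_le_comm₀ hcard (by rw [mul_comm]; positivity),
    inv_div, div_le_iff₀ (by linarith)]
  linarith

theorem prod_sum_pow_le (N M : ℕ) :
    ∏ i : Fin N, ∑ j ∈ Finset.range M, (((1 / 2 : ℝ)) ^ (i.1 + 1)) ^ j ≤ Real.exp 2 := by
  have hfac : ∀ i : Fin N, ∑ j ∈ Finset.range M, (((1 / 2 : ℝ)) ^ (i.1 + 1)) ^ j ≤
      Real.exp ((1 / 2 : ℝ) ^ i.1) := by
    intro i
    have h1 : ((1 / 2 : ℝ)) ^ (i.1 + 1) ≤ 1 / 2 := by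
      simpa using pow_le_pow_of_le_one (by norm_num : (0 : ℝ) ≤ 1 / 2) (by norm_num)
        (Nat.succ_le_succ (Nat.zero_le i.1))
    have h0 : 0 < ((1 / 2 : ℝ)) ^ (i.1 + 1) := by positivity
    calc ∑ j ∈ Finset.range M, (((1 / 2 : ℝ)) ^ (i.1 + 1)) ^ j
        ≤ ∑' j, (((1 / 2 : ℝ)) ^ (i.1 + 1)) ^ j :=
          (summable_geometric_of_lt_one h0.le (by linarith)).sum_le_tsum _
            (fun j _ => by positivity)
      _ = (1 - (1 / 2 : ℝ) ^ (i.1 + 1))⁻¹ := tsum_geometric_of_lt_one h0.le (by linarith)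
      _ ≤ 1 + 2 * (1 / 2 : ℝ) ^ (i.1 + 1) := by
          rw [inv_le_iff_one_le_mul₀ (by linarith)]
          nlinarith
      _ = (1 / 2 : ℝ) ^ i.1 + 1 := by rw [pow_succ]; ring
      _ ≤ _ := Real.add_one_le_exp _
  calc ∏ i : Fin N, ∑ j ∈ Finset.range M, (((1 / 2 : ℝ)) ^ (i.1 + 1)) ^ j
      ≤ ∏ i : Fin N, Real.exp ((1 / 2 : ℝ) ^ i.1) :=
        Finset.prod_le_prod (fun i _ => Finset.sum_nonneg fun j _ => by positivity)
          fun i _ => hfac i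
    _ = Real.exp (∑ i : Fin N, (1 / 2 : ℝ) ^ i.1) := (Real.exp_sum _ _).symm
    _ ≤ Real.exp 2 := by
        refine Real.exp_le_exp.2 ?_
        rw [Fin.sum_univ_eq_sum_range (fun i => (1 / 2 : ℝ) ^ i) N]
        exact (summable_geometric_two.sum_le_tsum _ (fun j _ => by positivity)).trans
          tsum_geometric_two.le

theorem PartitionsAll.size_eq_sum_count {N : ℕ} {l : PartitionsAll} (hl : l.1 ≤ N) :
    l.1 = ∑ i : Fin N, (i.1 + 1) * l.2.parts.count (i.1 + 1) := by
  have hsub : l.2.parts.toFinset ⊆ (Finset.range N).image (· + 1) := by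
    intro i hi
    rw [Multiset.mem_toFinset] at hi
    have h0 := l.2.parts_pos hi
    have h1 := l.2.le_of_mem_parts hi
    exact Finset.mem_image.2 ⟨i - 1, Finset.mem_range.2 (by omega), by omega⟩
  have h := Finset.sum_multiset_count_of_subset _ _ hsub
  rw [l.2.parts_sum, Finset.sum_image (by simp)] at h
  refine h.trans ?_
  rw [← Fin.sum_univ_eq_sum_range (fun i => l.2.parts.count (i + 1) • (i + 1)) N]
  exact Finset.sum_congr rfl fun i _ => by rw [smul_eq_mul, mul_comm]

theorem summable_half_pow_size :
    Summable fun l : PartitionsAll => (1 / 2 : ℝ) ^ l.1 := by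
  classical
  refine summable_of_sum_le (c := Real.exp 2) (fun l => by positivity) fun s => ?_
  set N := s.sup (fun l => l.1) with hN
  have hle : ∀ l ∈ s, l.1 ≤ N := fun l hl => Finset.le_sup (f := fun l : PartitionsAll => l.1) hl
  let e : PartitionsAll → Fin N → ℕ := fun l i => l.2.parts.count (i.1 + 1)
  have hinj : Set.InjOn e s := by
    intro l hl m hm hlm
    refine PartitionsAll.eq_of_parts_eq (Multiset.ext.2 fun k => ?_)
    by_cases hk : 1 ≤ k ∧ k ≤ N
    · have := congrFun hlm ⟨k - 1, by omega⟩
      simpa [e, Nat.sub_add_cancel hk.1] using this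
    · have aux : ∀ l ∈ s, l.2.parts.count k = 0 := by
        intro l hl
        refine Multiset.count_eq_zero.2 fun hkl => hk ⟨l.2.parts_pos hkl, ?_⟩
        exact (l.2.le_of_mem_parts hkl).trans (hle l hl)
      rw [aux l hl, aux m hm]
  have hval : ∀ l ∈ s, (1 / 2 : ℝ) ^ l.1 = ∏ i : Fin N, ((1 / 2 : ℝ) ^ (i.1 + 1)) ^ e l i := by
    intro l hl
    simp_rw [← pow_mul]
    rw [Finset.prod_pow_eq_pow_sum, ← PartitionsAll.size_eq_sum_count (hle l hl)]
  rw [Finset.sum_congr rfl hval,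
    ← Finset.sum_image (f := fun x : Fin N → ℕ => ∏ i : Fin N, ((1 / 2 : ℝ) ^ (i.1 + 1)) ^ x i)
      hinj]
  refine le_trans ?_ (prod_sum_pow_le N (N + 1))
  rw [Finset.prod_univ_sum]
  refine Finset.sum_le_sum_of_subset_of_nonneg ?_ fun x _ _ =>
    Finset.prod_nonneg fun i _ => by positivity
  intro x hx
  obtain ⟨l, hl, rfl⟩ := Finset.mem_image.1 hx
  refine Fintype.mem_piFinset.2 fun i => Finset.mem_range.2 (Nat.lt_succ_of_le ?_)
  refine le_trans ?_ (hle l hl)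
  rw [PartitionsAll.size_eq_sum_count (hle l hl)]
  refine le_trans ?_ (Finset.single_le_sum (f := fun i : Fin N =>
    (i.1 + 1) * l.2.parts.count (i.1 + 1)) (fun _ _ => Nat.zero_le _) (Finset.mem_univ i))
  exact Nat.le_mul_of_pos_left _ (Nat.succ_pos _)

theorem clC_mem {p : ℕ} (hp : p.Prime) : 0 ≤ clC p ∧ clC p ≤ 1 - (p : ℝ)⁻¹ := by
  set x : ℝ := (p : ℝ)⁻¹ with hx
  have hx0 : 0 ≤ x := by positivity
  have hx1 : x < 1 := inv_lt_one_of_one_lt₀ (by exact_mod_cast hp.one_lt)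
  have hfac : ∀ k : ℕ, 0 ≤ 1 - x ^ k ∧ 1 - x ^ k ≤ 1 := fun k =>
    ⟨sub_nonneg.2 (pow_le_one₀ hx0 hx1.le), by linarith [pow_nonneg hx0 k]⟩
  have hs : Summable fun i : ℕ => -x ^ (i + 1) :=
    ((summable_nat_add_iff 1).2 (summable_geometric_of_lt_one hx0 hx1)).neg
  have hm := (Real.multipliable_one_add_of_summable hs).hasProd.tendsto_prod_nat
  simp only [← sub_eq_add_neg] at hm
  have hm' := (tendsto_add_atTop_iff_nat 1).2 hm
  refine ⟨ge_of_tendsto' hm' fun n => Finset.prod_nonneg fun i _ => (hfac _).1,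
    le_of_tendsto' hm' fun n => ?_⟩
  rw [Finset.prod_range_succ', zero_add, pow_one]
  exact mul_le_of_le_one_left (by linarith)
    (Finset.prod_le_one (fun i _ => (hfac _).1) fun i _ => (hfac _).2)

theorem partOne_ne_zero : partOne ≠ 0 := fun h =>
  absurd (congrArg (fun l : PartitionsAll => l.1) h) (by decide)

/-- The total weight of all groups of order at least `p ^ 2` is at most `tailConst / p ^ 2`. -/
noncomputable def tailConst : ℝ := 8 * ∑' l : PartitionsAll, (1 / 2 : ℝ) ^ l.1

theorem tailConst_nonneg : 0 ≤ tailConst :=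
  mul_nonneg (by norm_num) (tsum_nonneg fun _ => by positivity)

open Classical in
theorem wCL_le_of_ne_zero {p : ℕ} (hp : p.Prime) {l : PartitionsAll} (hl : l ≠ 0) :
    wCL p l ≤ (if l = partOne then ((p : ℝ) - 1)⁻¹ else 0) +
      8 / (p : ℝ) ^ 2 * (1 / 2 : ℝ) ^ l.1 := by
  have hp2 : (2 : ℝ) ≤ p := by exact_mod_cast hp.two_le
  have hsize : l.1 ≠ 0 := fun h => hl (PartitionsAll.eq_zero_of_size h)
  have h := wCL_le hp hsize
  split_ifs with h1
  · have hone : l.1 = 1 := by rw [h1]; rfl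
    rw [hone] at h ⊢
    have : (p / (p - 1) : ℝ) * ((p : ℝ)⁻¹) ^ 1 = ((p : ℝ) - 1)⁻¹ := by
      have : (p : ℝ) - 1 ≠ 0 := by linarith
      field_simp
    rw [this] at h
    have : 0 ≤ 8 / (p : ℝ) ^ 2 * (1 / 2 : ℝ) ^ 1 := by positivity
    linarith
  · have hone : l.1 ≠ 1 := fun h => h1 (PartitionsAll.eq_partOne_of_size h)
    obtain ⟨k, hk⟩ : ∃ k, l.1 = k + 2 := ⟨l.1 - 2, by omega⟩
    rw [hk] at h ⊢
    have hdiv : (p / (p - 1) : ℝ) ≤ 2 := by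
      rw [div_le_iff₀ (by linarith)]; linarith
    have hpow : ((p : ℝ)⁻¹) ^ k ≤ (1 / 2 : ℝ) ^ k := by
      gcongr
      rw [one_div]
      gcongr
    calc wCL p l ≤ (p / (p - 1) : ℝ) * ((p : ℝ)⁻¹) ^ (k + 2) := h
      _ ≤ 2 * ((1 / 2 : ℝ) ^ k * ((p : ℝ)⁻¹) ^ 2) := by
          rw [pow_add]; gcongr
      _ = 0 + 8 / (p : ℝ) ^ 2 * (1 / 2 : ℝ) ^ (k + 2) := by
          rw [pow_add]; ring

theorem summable_wCL {p : ℕ} (hp : p.Prime) : Summable (wCL p) := by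
  classical
  have hs : Summable fun l : PartitionsAll => (if l = 0 then (1 : ℝ) else 0) +
      ((if l = partOne then ((p : ℝ) - 1)⁻¹ else 0) + 8 / (p : ℝ) ^ 2 * (1 / 2 : ℝ) ^ l.1) :=
    (hasSum_ite_eq _ _).summable.add
      ((hasSum_ite_eq _ _).summable.add (summable_half_pow_size.mul_left _))
  refine Summable.of_nonneg_of_le (wCL_nonneg p) (fun l => ?_) hs
  by_cases hl : l = 0
  · have : 0 ≤ 8 / (p : ℝ) ^ 2 * (1 / 2 : ℝ) ^ l.1 := by positivity
    simp only [hl, if_true, partOne_ne_zero.symm, if_false, zero_add]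
    rw [hl] at this
    linarith [wCL_le_one p 0]
  · simp only [hl, if_false, zero_add]
    exact wCL_le_of_ne_zero hp hl

theorem tsum_wCL_le_of_zero_notMem {p : ℕ} (hp : p.Prime) {S : Set PartitionsAll}
    (hS : (0 : PartitionsAll) ∉ S) :
    ∑' l : S, wCL p l ≤ ((p : ℝ) - 1)⁻¹ + tailConst / (p : ℝ) ^ 2 := by
  classical
  have hp2 : (2 : ℝ) ≤ p := by exact_mod_cast hp.two_le
  have hs1 : HasSum (fun l : PartitionsAll => if l = partOne then ((p : ℝ) - 1)⁻¹ else 0) _ :=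
    hasSum_ite_eq _ _
  have hs := hs1.add (summable_half_pow_size.hasSum.mul_left (8 / (p : ℝ) ^ 2))
  rw [tsum_subtype S (wCL p)]
  refine (Summable.tsum_le_tsum (fun l => ?_) ((summable_wCL hp).indicator S)
    hs.summable).trans_eq ?_
  · by_cases hl : l ∈ S
    · rw [Set.indicator_of_mem hl]
      exact wCL_le_of_ne_zero hp fun h => hS (h ▸ hl)
    · rw [Set.indicator_of_notMem hl]
      have : 0 ≤ ((p : ℝ) - 1)⁻¹ := inv_nonneg.2 (by linarith)
      split_ifs <;> positivity
  · rw [hs.tsum_eq, tailConst]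
    ring

theorem Pp_nonneg {p : ℕ} (hp : p.Prime) (S : Set PartitionsAll) : 0 ≤ Pp p S :=
  mul_nonneg (tsum_nonneg fun _ => wCL_nonneg _ _) (clC_mem hp).1

theorem Pp_le_of_zero_notMem {p : ℕ} (hp : p.Prime) {S : Set PartitionsAll}
    (hS : (0 : PartitionsAll) ∉ S) :
    Pp p S ≤ ((p : ℝ) - 1)⁻¹ + tailConst / (p : ℝ) ^ 2 := by
  refine (mul_le_of_le_one_right (tsum_nonneg fun _ => wCL_nonneg _ _) ?_).trans
    (tsum_wCL_le_of_zero_notMem hp hS)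
  have : 0 ≤ (p : ℝ)⁻¹ := by positivity
  linarith [(clC_mem hp).2]

theorem Pp_le {p : ℕ} (hp : p.Prime) (S : Set PartitionsAll) :
    Pp p S ≤ 1 + tailConst / (p : ℝ) ^ 2 := by
  classical
  have hp2 : (2 : ℝ) ≤ p := by exact_mod_cast hp.two_le
  have hsum : ∑' l : S, wCL p l ≤ 1 + (((p : ℝ) - 1)⁻¹ + tailConst / (p : ℝ) ^ 2) := by
    have h1 : ∑' l : S, wCL p l ≤ ∑' l, wCL p l := by
      rw [tsum_subtype S (wCL p)]
      exact Summable.tsum_le_tsum (Set.indicator_le_self' fun l _ => wCL_nonneg p l)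
        ((summable_wCL hp).indicator S) (summable_wCL hp)
    have h2 := (summable_wCL hp).tsum_subtype_add_tsum_subtype_compl {0}
    have h3 := tsum_wCL_le_of_zero_notMem hp (S := {0}ᶜ) (by simp)
    have h4 : ∑' l : ({0} : Set PartitionsAll), wCL p l = wCL p 0 := tsum_singleton 0 (wCL p)
    linarith [wCL_le_one p 0]
  have hc := clC_mem hp
  have hc1 : clC p ≤ 1 := hc.2.trans (by simp)
  have hC := tailConst_nonneg
  calc Pp p S ≤ (1 + (((p : ℝ) - 1)⁻¹ + tailConst / (p : ℝ) ^ 2)) * clC p :=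
        mul_le_mul_of_nonneg_right hsum hc.1
    _ = (1 + ((p : ℝ) - 1)⁻¹) * clC p + tailConst / (p : ℝ) ^ 2 * clC p := by ring
    _ ≤ (1 + ((p : ℝ) - 1)⁻¹) * (1 - (p : ℝ)⁻¹) + tailConst / (p : ℝ) ^ 2 * 1 := by
        have : 0 ≤ ((p : ℝ) - 1)⁻¹ := inv_nonneg.2 (by linarith)
        gcongr
        exact hc.2
    _ = 1 + tailConst / (p : ℝ) ^ 2 := by
        have : (p : ℝ) - 1 ≠ 0 := by linarith
        field_simp
        ring

theorem prime_of_mem_primesUpTo {x p : ℕ} (h : p ∈ primesUpTo x) : p.Prime :=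
  Nat.prime_of_mem_primesBelow h

theorem primesUpTo_mono : Monotone primesUpTo := fun _ _ h =>
  Finset.filter_subset_filter _ (Finset.range_mono (Nat.succ_le_succ h))

theorem prod_primesUpTo_le (x : ℕ) :
    ∏ p ∈ primesUpTo x, (1 + tailConst / (p : ℝ) ^ 2) ≤
      Real.exp (∑' n : ℕ, tailConst / (n : ℝ) ^ 2) := by
  have hC := tailConst_nonneg
  have hs : Summable fun n : ℕ => tailConst / (n : ℝ) ^ 2 := by
    simpa [div_eq_mul_inv] using
      ((Real.summable_nat_pow_inv (p := 2)).2 one_lt_two).mul_left tailConst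
  calc ∏ p ∈ primesUpTo x, (1 + tailConst / (p : ℝ) ^ 2)
      ≤ ∏ p ∈ primesUpTo x, Real.exp (tailConst / (p : ℝ) ^ 2) :=
        Finset.prod_le_prod (fun p _ => by positivity) fun p _ => by
          rw [add_comm]; exact Real.add_one_le_exp _
    _ = Real.exp (∑ p ∈ primesUpTo x, tailConst / (p : ℝ) ^ 2) := (Real.exp_sum _ _).symm
    _ ≤ _ := Real.exp_le_exp.2 (hs.sum_le_tsum _ fun n _ => by positivity)

theorem exists_tendsto_globPartial (S : Set PartitionsAll) :
    ∃ L, Tendsto (globPartial S) atTop (𝓝 L) := by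
  have hC := tailConst_nonneg
  have hu : ∀ p : ℕ, (1 : ℝ) ≤ 1 + tailConst / (p : ℝ) ^ 2 := fun p => by
    have : 0 ≤ tailConst / (p : ℝ) ^ 2 := by positivity
    linarith
  have hmono : Monotone fun x => ∏ p ∈ primesUpTo x, (1 + tailConst / (p : ℝ) ^ 2) :=
    fun x y hxy => Finset.prod_le_prod_of_subset_of_one_le (primesUpTo_mono hxy)
      (fun p _ => zero_le_one.trans (hu p)) fun p _ _ => hu p
  have hlim1 := tendsto_atTop_ciSup hmono
    ⟨_, by rintro _ ⟨x, rfl⟩; exact prod_primesUpTo_le x⟩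
  have hq : ∀ p : ℕ, p.Prime → 0 ≤ Pp p S / (1 + tailConst / (p : ℝ) ^ 2) ∧
      Pp p S / (1 + tailConst / (p : ℝ) ^ 2) ≤ 1 := fun p hp =>
    ⟨div_nonneg (Pp_nonneg hp S) (zero_le_one.trans (hu p)),
      (div_le_one (zero_lt_one.trans_le (hu p))).2 (Pp_le hp S)⟩
  have hanti : Antitone fun x =>
      ∏ p ∈ primesUpTo x, Pp p S / (1 + tailConst / (p : ℝ) ^ 2) := fun x y hxy => by
    dsimp only
    rw [← Finset.prod_sdiff (primesUpTo_mono hxy)]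
    refine mul_le_of_le_one_left
      (Finset.prod_nonneg fun p hp => (hq p (prime_of_mem_primesUpTo hp)).1) ?_
    have hmem : ∀ p ∈ primesUpTo y \ primesUpTo x, p.Prime := fun p hp =>
      prime_of_mem_primesUpTo (Finset.mem_sdiff.1 hp).1
    exact Finset.prod_le_one (fun p hp => (hq p (hmem p hp)).1) fun p hp => (hq p (hmem p hp)).2
  have hlim2 := tendsto_atTop_ciInf hanti ⟨0, by
    rintro _ ⟨x, rfl⟩
    exact Finset.prod_nonneg fun p hp => (hq p (prime_of_mem_primesUpTo hp)).1⟩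
  refine ⟨_, (hlim1.mul hlim2).congr fun x => ?_⟩
  rw [← Finset.prod_mul_distrib]
  exact Finset.prod_congr rfl fun p _ => mul_div_cancel₀ _ (zero_lt_one.trans_le (hu p)).ne'

theorem tendsto_globPartial (S : Set PartitionsAll) :
    Tendsto (globPartial S) atTop (𝓝 (glob S)) :=
  tendsto_nhds_limUnder (exists_tendsto_globPartial S)

theorem globPartial_prime {q : ℕ} (hq : q.Prime) (S : Set PartitionsAll) :
    globPartial S q = Pp q S * globPartial S (q - 1) := by
  unfold globPartial primesUpTo
  rw [Nat.sub_add_cancel hq.one_lt.le, Nat.primesBelow_succ, if_pos hq,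
    Finset.prod_insert (by simp [Nat.primesBelow])]

theorem glob_eq_zero {S : Set PartitionsAll} (hS : (0 : PartitionsAll) ∉ S) : glob S = 0 := by
  have hq : Tendsto (Nat.nth Nat.Prime) atTop atTop :=
    (Nat.nth_strictMono Nat.infinite_setOfPred_prime).tendsto_atTop
  have hprime : ∀ n, (Nat.nth Nat.Prime n).Prime := Nat.prime_nth_prime
  have hpred : Tendsto (fun n => Nat.nth Nat.Prime n - 1) atTop atTop :=
    (tendsto_sub_atTop_nat 1).comp hq
  have hcast : Tendsto (fun n => (Nat.nth Nat.Prime n : ℝ)) atTop atTop :=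
    tendsto_natCast_atTop_atTop.comp hq
  have hbound : Tendsto (fun n => ((Nat.nth Nat.Prime n : ℝ) - 1)⁻¹ +
      tailConst / (Nat.nth Nat.Prime n : ℝ) ^ 2) atTop (𝓝 0) := by
    have h1 := tendsto_inv_atTop_zero.comp (tendsto_atTop_add_const_right _ (-1 : ℝ) hcast)
    have h2 := ((tendsto_pow_atTop two_ne_zero).comp hcast).const_div_atTop tailConst
    simpa [sub_eq_add_neg] using h1.add h2
  have hP : Tendsto (fun n => Pp (Nat.nth Nat.Prime n) S) atTop (𝓝 0) :=
    squeeze_zero (fun n => Pp_nonneg (hprime n) S)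
      (fun n => Pp_le_of_zero_notMem (hprime n) hS) hbound
  have hprod := hP.mul ((tendsto_globPartial S).comp hpred)
  rw [zero_mul] at hprod
  refine tendsto_nhds_unique ((tendsto_globPartial S).comp hq) (hprod.congr fun n => ?_)
  exact (globPartial_prime (hprime n) S).symm

open MeasureTheory

instance inst_s14 : Countable PartitionsAll := inferInstanceAs (Countable (Σ n : ℕ, Nat.Partition n))

instance inst_s14_2 : MeasurableSpace PartitionsAll := ⊤

instance : DiscreteMeasurableSpace PartitionsAll := ⟨fun _ => trivial⟩

/-- The local Cohen–Lenstra measure with `localMeasure p S = P_p(S)`. -/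
noncomputable def localMeasure (p : ℕ) : Measure PartitionsAll :=
  Measure.sum fun l => ENNReal.ofReal (wCL p l * clC p) • Measure.dirac l

theorem localMeasure_apply {p : ℕ} (hp : p.Prime) (S : Set PartitionsAll) :
    localMeasure p S = ENNReal.ofReal (Pp p S) := by
  have hnn : ∀ l, 0 ≤ wCL p l * clC p := fun l => mul_nonneg (wCL_nonneg p l) (clC_mem hp).1
  rw [localMeasure, Measure.sum_apply _ (.of_discrete), Pp, ← tsum_mul_right,
    tsum_subtype S (fun l => wCL p l * clC p),
    ENNReal.ofReal_tsum_of_nonneg (fun l => Set.indicator_nonneg (fun l _ => hnn l) l)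
      (((summable_wCL hp).mul_right _).indicator S)]
  refine tsum_congr fun l => ?_
  by_cases hl : l ∈ S <;> simp [hl]

theorem isFiniteMeasure_localMeasure {p : ℕ} (hp : p.Prime) :
    IsFiniteMeasure (localMeasure p) :=
  ⟨by rw [localMeasure_apply hp]; exact ENNReal.ofReal_lt_top⟩

instance (x : ℕ) (p : primesUpTo x) : IsFiniteMeasure (localMeasure p) :=
  isFiniteMeasure_localMeasure (prime_of_mem_primesUpTo p.2)

instance : MeasurableSpace GG := ⊤

instance : DiscreteMeasurableSpace GG := ⟨fun _ => trivial⟩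

/-- Extend a family of partitions indexed by the primes `≤ x` by the empty partition. -/
noncomputable def extendZero (x : ℕ) (g : primesUpTo x → PartitionsAll) : GG :=
  Finsupp.ofSupportFinite
    (fun p : Nat.Primes => if h : (p : ℕ) ∈ primesUpTo x then g ⟨p, h⟩ else 0) <| by
    refine ((primesUpTo x).finite_toSet.preimage
      (Nat.Primes.coe_nat_injective.injOn)).subset fun p hp => ?_
    by_contra h
    exact hp (dif_neg h)

theorem extendZero_apply (x : ℕ) (g : primesUpTo x → PartitionsAll) (p : Nat.Primes) :
    extendZero x g p = if h : (p : ℕ) ∈ primesUpTo x then g ⟨p, h⟩ else 0 := rfl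

/-- The product of the local measures at the primes `≤ x`, as a measure on groups whose order
is supported on these primes. -/
noncomputable def truncMeasure (x : ℕ) : Measure GG :=
  (Measure.pi fun p : primesUpTo x => localMeasure p).map (extendZero x)

instance (x : ℕ) : IsFiniteMeasure (truncMeasure x) := by
  unfold truncMeasure; infer_instance

theorem Oset_eq_empty {S : Set PartitionsAll} (hS : (0 : PartitionsAll) ∉ S) : Oset S = ∅ := by
  refine Set.eq_empty_of_forall_notMem fun G hG => ?_
  obtain ⟨p, hp⟩ := Set.Infinite.exists_notMem_finset (s := Set.univ) Set.infinite_univ G.support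
  exact hS (Finsupp.notMem_support_iff.1 hp.2 ▸ hG p)

theorem truncMeasure_Oset {S : Set PartitionsAll} (hS : (0 : PartitionsAll) ∈ S) (x : ℕ) :
    (truncMeasure x).real (Oset S) = globPartial S x := by
  have hpre : extendZero x ⁻¹' Oset S = Set.univ.pi fun _ => S := by
    ext g
    refine ⟨fun hg p _ => ?_, fun hg p => ?_⟩
    · have hmem : ∀ (q : Nat.Primes) (hq : (q : ℕ) ∈ primesUpTo x), g ⟨q, hq⟩ ∈ S := by
        intro q hq
        have := hg q
        rwa [extendZero_apply, dif_pos hq] at this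
      exact hmem ⟨p, prime_of_mem_primesUpTo p.2⟩ p.2
    · rw [extendZero_apply]
      split_ifs with h
      · exact hg _ trivial
      · exact hS
  rw [measureReal_def, truncMeasure, Measure.map_apply .of_discrete .of_discrete, hpre,
    Measure.pi_pi, ENNReal.toReal_prod, globPartial, ← Finset.prod_coe_sort (primesUpTo x)]
  refine Finset.prod_congr rfl fun p _ => ?_
  have hp := prime_of_mem_primesUpTo p.2
  rw [localMeasure_apply hp, ENNReal.toReal_ofReal (Pp_nonneg hp S)]

theorem tendsto_truncMeasure_Oset (S : Set PartitionsAll) :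
    Tendsto (fun x => (truncMeasure x).real (Oset S)) atTop (𝓝 (glob S)) := by
  by_cases hS : (0 : PartitionsAll) ∈ S
  · simpa only [truncMeasure_Oset hS] using tendsto_globPartial S
  · simp [Oset_eq_empty hS, glob_eq_zero hS]

theorem tendsto_truncMeasure_OOset {r : ℕ} (E : Fin r → Set PartitionsAll) :
    Tendsto (fun x => (truncMeasure x).real (OOset E)) atTop (𝓝 (PO E)) := by
  have hval : ∀ x, (truncMeasure x).real (OOset E) =
      ∑ T ∈ Finset.univ.filter (fun T : Finset (Fin r) => T.Nonempty),
        (-1 : ℝ) ^ (T.card + 1) * (truncMeasure x).real (Oset (⋂ i ∈ T, E i)) := by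
    intro x
    have h := measureReal_biUnion_eq_sum_powerset (μ := truncMeasure x) (t := Finset.univ)
      (s := fun i => Oset (E i)) fun i _ => .of_discrete
    rw [OOset, ← Set.biUnion_univ, ← Finset.coe_univ]
    refine h.trans ?_
    rw [Finset.powerset_univ]
    refine Finset.sum_congr rfl fun T _ => ?_
    congr 2
    ext G
    simp only [Oset, Set.mem_iInter, Set.mem_ofPred_eq]
    exact ⟨fun h p i hi => h i hi p, fun h i hi p => h p i hi⟩
  simp only [hval]
  exact tendsto_finsetSum _ fun T _ => (tendsto_truncMeasure_Oset _).const_mul _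

/-- If `D₀ ∈ 𝔇` is covered by finitely many `D₁, …, D_n ∈ 𝔇`, then
`P(D₀) ≤ ∑ᵢ P(Dᵢ)`. -/
theorem PD_le_sum_of_subset_union
    (n r0 s0 : ℕ) (E0 : Fin r0 → Set PartitionsAll) (F0 : Fin s0 → Set PartitionsAll)
    (r s : Fin n → ℕ) (E : ∀ i, Fin (r i) → Set PartitionsAll)
    (F : ∀ i, Fin (s i) → Set PartitionsAll)
    (h0 : OOset F0 ⊆ OOset E0)
    (h : ∀ i, OOset (F i) ⊆ OOset (E i))
    (hcover : OOset E0 \ OOset F0 ⊆ ⋃ i, OOset (E i) \ OOset (F i)) :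
    PO E0 - PO F0 ≤ ∑ i, (PO (E i) - PO (F i)) := by
  have hlim : ∀ {r s : ℕ} (E : Fin r → Set PartitionsAll) (F : Fin s → Set PartitionsAll),
      OOset F ⊆ OOset E → Tendsto (fun x => (truncMeasure x).real (OOset E \ OOset F)) atTop
        (𝓝 (PO E - PO F)) := fun E F hFE => by
    refine ((tendsto_truncMeasure_OOset E).sub (tendsto_truncMeasure_OOset F)).congr fun x => ?_
    exact (measureReal_sdiff hFE .of_discrete).symm
  refine le_of_tendsto_of_tendsto' (hlim E0 F0 h0)
    (tendsto_finsetSum _ fun i _ => hlim (E i) (F i) (h i)) fun x => ?_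
  exact (measureReal_mono hcover).trans (measureReal_iUnion_fintype_le _)
end
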